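/- arXiv:math/0408277 — 7 statements merged into one kernel-verified Lean document; each statement's English description precedes it below -/
import Mathlib

section
/- Theorem 1: For every root class 𝒦, every free group (on any set of generators) is 𝒦-residual. -/
open Pointwise

universe u

/-- A class of groups in universe `u`. -/
abbrev GroupClass : Type (u + 1) := ∀ (G : Type u) [Group G], Prop

/-- A class of groups is invariant under isomorphism. -/
def GroupClass.IsoInvariant (K : GroupClass.{u}) : Prop :=
  ∀ (G H : Type u) [Group G] [Group H], G ≃* H → K G → K H

/-- A class of groups is closed under taking subgroups. -/
def GroupClass.SubgroupClosed (K : GroupClass.{u}) : Prop :=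
  ∀ (G : Type u) [Group G], K G → ∀ H : Subgroup G, K H

/-- A class of groups is closed under binary direct products. -/
def GroupClass.ProdClosed (K : GroupClass.{u}) : Prop :=
  ∀ (A B : Type u) [Group A] [Group B], K A → K B → K (A × B)

/-- `K` is a root class: it is an isomorphism-invariant class of groups containing a
nontrivial group, closed under subgroups and finite direct products, and satisfying the
root condition on subnormal chains `C ⊴ B ⊴ A` of length two. -/
def IsRootClass (K : GroupClass.{u}) : Prop :=
  K.IsoInvariant ∧
  (∃ (G : Type u) (_ : Group G), Nontrivial G ∧ K G) ∧
  K.SubgroupClosed ∧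
  K.ProdClosed ∧
  (∀ (A : Type u) [Group A] (B : Subgroup A) [B.Normal] (C : Subgroup B) [C.Normal],
    K (A ⧸ B) → K ((B : Type u) ⧸ C) →
    ∃ (D : Subgroup A) (hD : D.Normal), D ≤ C.map B.subtype ∧ (letI := hD; K (A ⧸ D)))

/-- A group `G` is `K`-residual: every nonidentity element is excluded from some normal
subgroup with quotient in `K`. -/
def KResidual (K : GroupClass.{u}) (G : Type u) [Group G] : Prop :=
  ∀ g : G, g ≠ 1 → ∃ (N : Subgroup G) (hN : N.Normal),
    (letI := hN; K (G ⧸ N)) ∧ g ∉ N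

/-- A subgroup `H` of `A` is `K`-closed: every element of `A` outside `H` avoids the set
`N * H` for some normal subgroup `N` of `A` with `A ⧸ N ∈ K`. -/
def KClosed (K : GroupClass.{u}) {A : Type u} [Group A] (H : Subgroup A) : Prop :=
  ∀ a : A, a ∉ H → ∃ (N : Subgroup A) (hN : N.Normal),
    (letI := hN; K (A ⧸ N)) ∧ a ∉ (N : Set A) * (H : Set A)

namespace RootAux

/-- Evaluation of a word. -/
def ev {α H : Type u} [Group H] (f : α → H) (L : List (α × Bool)) : H :=
  (L.map fun x => cond x.2 (f x.1) (f x.1)⁻¹).prod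

/-- The word is nontrivial in some group of the class. -/
def Good (K : GroupClass.{u}) {α : Type u} (L : List (α × Bool)) : Prop :=
  ∃ (H : Type u) (_ : Group H) (f : α → H), K H ∧ ev f L ≠ 1

lemma ev_nil {α H : Type u} [Group H] (f : α → H) : ev f [] = 1 := rfl

lemma ev_cons {α H : Type u} [Group H] (f : α → H) (l : α × Bool) (L : List (α × Bool)) :
    ev f (l :: L) = cond l.2 (f l.1) (f l.1)⁻¹ * ev f L := by simp [ev]

lemma ev_append {α H : Type u} [Group H] (f : α → H) (L M : List (α × Bool)) :
    ev f (L ++ M) = ev f L * ev f M := by simp [ev]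

lemma map_ev {α H H' : Type u} [Group H] [Group H'] (φ : H →* H') (f : α → H)
    (L : List (α × Bool)) : φ (ev f L) = ev (fun a => φ (f a)) L := by
  induction L with
  | nil => simp [ev_nil]
  | cons l L ih =>
    rw [ev_cons, ev_cons, map_mul, ih]
    rcases l with ⟨a, _ | _⟩ <;> simp

lemma ker_quot {K : GroupClass.{u}} (hK : IsRootClass K) {A H : Type u} [Group A] [Group H]
    (φ : A →* H) (h : K H) : K (A ⧸ φ.ker) :=
  hK.1 _ _ (QuotientGroup.quotientKerEquivRange φ).symm (hK.2.2.1 H h φ.range)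

lemma wreath {K : GroupClass.{u}} (hK : IsRootClass K) {X Y : Type u} [Group X] [Group Y]
    (hX : K X) (hY : K Y) : K (RegularWreathProduct X Y) := by
  let B : Subgroup (RegularWreathProduct X Y) :=
    (RegularWreathProduct.rightHom : RegularWreathProduct X Y →* Y).ker
  have hB : ∀ b : B, b.1.right = 1 := fun b => b.2
  let φ : B →* X :=
    { toFun := fun b => b.1.left 1
      map_one' := rfl
      map_mul' := fun a b => by simp [hB a] }
  obtain ⟨D, hD, hDC, hKD⟩ := hK.2.2.2.2 (RegularWreathProduct X Y) B φ.ker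
    (ker_quot hK _ hY) (ker_quot hK φ hX)
  have hd : ∀ d ∈ D, d.right = 1 ∧ d.left 1 = 1 := by
    intro d hd
    obtain ⟨b, hb, rfl⟩ := hDC hd
    exact ⟨hB b, hb⟩
  have hbot : D = ⊥ := by
    rw [eq_bot_iff]
    intro d hdD
    rw [Subgroup.mem_bot]
    ext y
    · have h := (hd _ (hD.conj_mem d hdD (RegularWreathProduct.inl y⁻¹))).2
      simpa using h
    · exact (hd d hdD).1
  subst hbot
  exact hK.1 _ _ QuotientGroup.quotientBot hKD

open Classical in
/-- The lift of a map to the wreath product. -/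
noncomputable def wl {α H X : Type u} [Group H] [Group X] (f : α → H) (c : X) (x : α) :
    α → RegularWreathProduct X H :=
  fun j => ⟨fun y => if j = x ∧ y = 1 then c else 1, f j⟩

lemma left_eq_one {α H X : Type u} [Group H] [Group X] (f : α → H) (c : X) (x : α)
    (M : List (α × Bool)) : ∀ (y : H)
    (_ : ∀ A B, M = A ++ (x, true) :: B → ev f A ≠ y)
    (_ : ∀ A B, M = A ++ (x, false) :: B → ev f (A ++ [(x, false)]) ≠ y),
    (ev (wl f c x) M).left y = 1 := by
  induction M with
  | nil => intro y _ _; rfl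
  | cons l M ih =>
    intro y h1 h2
    rw [ev_cons, RegularWreathProduct.mul_left, Pi.mul_apply]
    have e2 : (cond l.2 (wl f c x l.1) (wl f c x l.1)⁻¹).right = cond l.2 (f l.1) (f l.1)⁻¹ := by
      rcases l with ⟨a, _ | _⟩ <;> rfl
    rw [e2, ih, mul_one]
    · rcases l with ⟨a, _ | _⟩
      · by_cases hax : a = x
        · subst hax
          have := h2 [] M rfl
          simp only [List.nil_append, ev_cons, ev_nil, cond_false, mul_one] at this
          have h3 : ¬ (f a * y = 1) := fun h => this (inv_eq_of_mul_eq_one_right h)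
          simp [wl, h3]
        · simp [wl, hax]
      · by_cases hax : a = x
        · subst hax
          have := h1 [] M rfl
          have h3 : ¬ y = 1 := fun h => this h.symm
          simp [wl, h3]
        · simp [wl, hax]
    · intro A B hM h
      refine h1 (l :: A) B (by rw [hM]; rfl) ?_
      rw [ev_cons, h]; group
    · intro A B hM h
      refine h2 (l :: A) B (by rw [hM]; rfl) ?_
      rw [List.cons_append, ev_cons, h]; group

lemma good_flip {K : GroupClass.{u}} {α : Type u} (L : List (α × Bool))
    (h : Good K (L.map fun l => (l.1, !l.2))) : Good K L := by
  obtain ⟨H, _, f, hH, hf⟩ := h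
  refine ⟨H, _, fun a => (f a)⁻¹, hH, ?_⟩
  convert hf using 1
  clear hf
  induction L with
  | nil => rfl
  | cons l L ih =>
    rw [List.map_cons, ev_cons, ev_cons, ih]
    rcases l with ⟨a, _ | _⟩ <;> simp

lemma multi {K : GroupClass.{u}} (hK : IsRootClass K) {α : Type u} (L : List (α × Bool)) (n : ℕ) :
    (∀ k, 0 < k → k ≤ n → Good K (L.take k)) →
    ∃ (H : Type u) (_ : Group H) (f : α → H), K H ∧
      ∀ k, 0 < k → k ≤ n → ev f (L.take k) ≠ 1 := by
  induction n with
  | zero =>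
    intro _
    obtain ⟨G, _, _, hG⟩ := hK.2.1
    exact ⟨G, _, fun _ => 1, hG, fun k h1 h2 => by omega⟩
  | succ n ih =>
    intro h
    obtain ⟨H, _, f, hH, hf⟩ := ih fun k h1 h2 => h k h1 (by omega)
    obtain ⟨H', _, f', hH', hf'⟩ := h (n + 1) (by omega) le_rfl
    refine ⟨H × H', inferInstance, fun a => (f a, f' a), hK.2.2.2.1 H H' hH hH', ?_⟩
    intro k h1 h2 he
    rcases Nat.lt_or_ge n k with h3 | h3
    · obtain rfl : k = n + 1 := by omega
      apply hf'
      have := map_ev (MonoidHom.snd H H') (fun a => (f a, f' a)) (L.take (n + 1))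
      rw [he, map_one] at this
      exact this.symm
    · apply hf k h1 h3
      have := map_ev (MonoidHom.fst H H') (fun a => (f a, f' a)) (L.take k)
      rw [he, map_one] at this
      exact this.symm

lemma good_pos {K : GroupClass.{u}} (hK : IsRootClass K) {α : Type u} (x : α)
    (M : List (α × Bool)) (hL : FreeGroup.IsReduced ((x, true) :: M))
    (ih : ∀ L' : List (α × Bool), L'.length < ((x, true) :: M).length →
      FreeGroup.IsReduced L' → L' ≠ [] → Good K L') : Good K ((x, true) :: M) := by
  by_cases hc : ∃ A, M = A ++ [(x, false)]
  · obtain ⟨A, rfl⟩ := hc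
    have hA : A ≠ [] := by
      rintro rfl
      simp at hL
    obtain ⟨H, _, f, hH, hf⟩ := ih A (by simp)
      (hL.infix ⟨[(x, true)], [(x, false)], by simp⟩) hA
    refine ⟨H, _, f, hH, ?_⟩
    rw [ev_cons, ev_append, ev_cons, ev_nil]
    simpa [← mul_assoc, conj_eq_one_iff] using hf
  · obtain ⟨H, _, f, hH, hf⟩ := multi hK ((x, true) :: M) M.length (by
      intro k h1 h2
      apply ih
      · simp; omega
      · exact hL.infix (List.take_prefix _ _).isInfix
      · simp; omega)
    have hpre : ∀ A B, M = A ++ B → B ≠ [] → ev f ((x, true) :: A) ≠ 1 := by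
      intro A B hM hB
      have h0 := List.length_pos_iff.mpr hB
      have := hf (A.length + 1) (by omega) (by rw [hM, List.length_append]; omega)
      simpa [hM] using this
    obtain ⟨G, _, hG, hKG⟩ := hK.2.1
    obtain ⟨c, hc1⟩ := exists_ne (1 : G)
    refine ⟨RegularWreathProduct G H, inferInstance, wl f c x, wreath hK hKG hH, ?_⟩
    intro he
    have h1 : (ev (wl f c x) ((x, true) :: M)).left 1 = 1 := by rw [he]; rfl
    rw [ev_cons, RegularWreathProduct.mul_left, Pi.mul_apply, left_eq_one] at h1
    · simp [wl] at h1
      exact hc1 h1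
    · intro A B hM h
      apply hpre A _ hM (by simp)
      rw [ev_cons, h]
      simp [wl]
    · intro A B hM h
      apply hpre (A ++ [(x, false)]) B (by simp [hM])
      · rintro rfl
        exact hc ⟨A, hM⟩
      · rw [ev_cons, h]
        simp [wl]

lemma good_all {K : GroupClass.{u}} (hK : IsRootClass K) {α : Type u} (n : ℕ) :
    ∀ L : List (α × Bool), L.length = n → FreeGroup.IsReduced L → L ≠ [] → Good K L := by
  induction n using Nat.strong_induction_on with
  | _ n ih =>
    intro L hn hL hne
    subst hn
    rcases L with _ | ⟨⟨x, _ | _⟩, M⟩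
    · exact absurd rfl hne
    · apply good_flip
      apply good_pos hK
      · have : FreeGroup.IsReduced (((x, false) :: M).map fun l => (l.1, !l.2)) := by
          unfold FreeGroup.IsReduced at hL ⊢
          rw [List.isChain_map]
          exact hL.imp fun a b h h' => by simp [h h']
        exact this
      · intro L' hlt hr h0
        exact ih L'.length (by simpa using hlt) L' rfl hr h0
    · apply good_pos hK x M hL
      intro L' hlt hr h0
      exact ih L'.length hlt L' rfl hr h0

end RootAux

/-- Theorem 1: for every root class `K`, every free group is `K`-residual. -/
theorem freeGroup_kResidual (K : GroupClass.{u}) (hK : IsRootClass K) (α : Type u) :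
    KResidual K (FreeGroup α) := by
  classical
  intro g hg
  obtain ⟨H, _, f, hH, hf⟩ := RootAux.good_all hK _ g.toWord rfl FreeGroup.isReduced_toWord
    (by simpa [FreeGroup.toWord_eq_nil_iff] using hg)
  refine ⟨(FreeGroup.lift f).ker, inferInstance, RootAux.ker_quot hK _ hH, ?_⟩
  intro hm
  apply hf
  rw [MonoidHom.mem_ker, ← FreeGroup.mk_toWord (x := g), FreeGroup.lift_mk] at hm
  exact hm
end

section
/- Theorem 2: Let 𝒦 be a root class and let (G_λ)_{λ ∈ Λ} be a family of groups each of which is 𝒦-residual. Then the free product of the family (G_λ)_{λ ∈ Λ} (the coproduct of groups) is 𝒦-residual. -/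
open Pointwise

universe u

open RegularWreathProduct in
theorem rc_wreath {K : GroupClass.{u}} (hK : IsRootClass K) (X Y : Type u) [Group X] [Group Y]
    (hX : K X) (hY : K Y) : K (RegularWreathProduct X Y) := by
  obtain ⟨hiso, -, -, -, hroot⟩ := hK
  let r : RegularWreathProduct X Y →* Y := rightHom
  let e : r.ker →* X :=
    { toFun := fun b => b.1.left 1
      map_one' := rfl
      map_mul' := by
        intro a b
        have ha : a.1.right = 1 := a.2
        simp [ha] }
  have hr : Function.Surjective r := fun y => ⟨inl y, rfl⟩
  have he : Function.Surjective e := fun x => ⟨⟨⟨fun _ => x, 1⟩, rfl⟩, rfl⟩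
  obtain ⟨D, hD, hle, hKD⟩ := hroot (RegularWreathProduct X Y) r.ker e.ker
    (hiso _ _ (QuotientGroup.quotientKerEquivOfSurjective r hr).symm hY)
    (hiso _ _ (QuotientGroup.quotientKerEquivOfSurjective e he).symm hX)
  have key : ∀ d ∈ D, d.right = 1 ∧ d.left 1 = 1 := by
    intro d hd
    obtain ⟨b, hb, rfl⟩ := hle hd
    exact ⟨b.2, hb⟩
  have hbot : D = ⊥ := by
    rw [eq_bot_iff]
    intro d hd
    rw [Subgroup.mem_bot]
    have h1 := (key d hd).1
    ext y
    · have := (key _ (hD.conj_mem d hd (inl y⁻¹))).2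
      simpa [h1] using this
    · exact h1
  subst hbot
  exact hiso _ _ QuotientGroup.quotientBot hKD

open Monoid RegularWreathProduct in
theorem rc_words {K : GroupClass.{u}} (hK : IsRootClass K)
    (ι : Type u) (G : ι → Type u) [∀ i, Group (G i)] (hG : ∀ i, KResidual K (G i))
    (L : List (Σ i, G i)) (h1 : ∀ l ∈ L, l.2 ≠ 1) (hc : L.IsChain fun l l' => l.1 ≠ l'.1) :
    ∃ (Y : Type u) (_ : Group Y) (φ : CoprodI G →* Y), K Y ∧
      ∀ p, p <+: L → p ≠ [] → φ (p.map fun l => CoprodI.of l.2).prod ≠ 1 := by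
  classical
  obtain ⟨X, _, hXn, hX⟩ := hK.2.1
  induction L with
  | nil =>
    refine ⟨X, inferInstance, 1, hX, ?_⟩
    intro p hp hn
    exact absurd (List.prefix_nil.1 hp) hn
  | cons a v ih =>
    obtain ⟨Y, _, φ, hY, hφ⟩ := ih (fun l hl => h1 l (List.mem_cons_of_mem _ hl)) hc.tail
    -- a homomorphism that is nontrivial on the first letter
    obtain ⟨N, hN, hKN, haN⟩ := hG a.1 a.2 (h1 a List.mem_cons_self)
    let α : CoprodI G →* (G a.1 ⧸ N) :=
      (QuotientGroup.mk' N).comp (CoprodI.lift (Pi.mulSingle a.1 (MonoidHom.id (G a.1))))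
    have hα : α (CoprodI.of a.2) ≠ 1 := by
      have : α (CoprodI.of a.2) = QuotientGroup.mk' N a.2 := by
        simp only [α, MonoidHom.comp_apply]
        rw [CoprodI.of_leftInverse]
      rw [this]
      simpa using haN
    suffices h : ∃ (W : Type u) (_ : Group W) (ψ : CoprodI G →* W), K W ∧
        ∀ q, q <+: v → q ≠ [] → ψ (CoprodI.of a.2 * (q.map fun l => CoprodI.of l.2).prod) ≠ 1 by
      obtain ⟨W, _, ψ, hW, hψ⟩ := h
      refine ⟨(G a.1 ⧸ N) × W, inferInstance, α.prod ψ, hK.2.2.2.1 _ _ hKN hW, ?_⟩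
      intro p hp hn
      rcases List.prefix_cons_iff.1 hp with rfl | ⟨q, rfl, hq2⟩
      · exact absurd rfl hn
      · by_cases hqn : q = []
        · subst hqn
          intro h
          apply hα
          simpa using congrArg Prod.fst h
        · intro h
          apply hψ q hq2 hqn
          simpa using congrArg Prod.snd h
    cases v with
    | nil =>
      refine ⟨X, inferInstance, 1, hX, ?_⟩
      intro p hp hn
      exact absurd (List.prefix_nil.1 hp) hn
    | cons b v =>
      obtain ⟨x, hx⟩ := exists_ne (1 : X)
      have hab : a.1 ≠ b.1 := by
        simp at hc
        exact hc.1
      let t : Y := (φ (CoprodI.of a.2))⁻¹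
      let H : RegularWreathProduct X Y := ⟨Pi.mulSingle t x, 1⟩
      let ψ : CoprodI G →* RegularWreathProduct X Y := CoprodI.lift fun i =>
        (if i = b.1 then (MulAut.conj H).toMonoidHom else MonoidHom.id _).comp
          (inl.comp (φ.comp CoprodI.of))
      have hψ1 : ∀ (i : ι) (g : G i) (z : Y), (ψ (CoprodI.of g)).left z =
          if i = b.1 then (Pi.mulSingle t x : Y → X) z *
            ((Pi.mulSingle t x : Y → X) ((φ (CoprodI.of g))⁻¹ * z))⁻¹ else 1 := by
        intro i g z
        by_cases h : i = b.1
        · simp [ψ, h, H]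
        · simp [ψ, h]
      have hψ2 : ∀ (i : ι) (g : G i), (ψ (CoprodI.of g)).right = φ (CoprodI.of g) := by
        intro i g
        by_cases h : i = b.1
        · simp [ψ, h, H]
        · simp [ψ, h]
      have tail : ∀ (q : List (Σ i, G i)) (z : Y),
          (∀ p, p <+: q → (φ (p.map fun l => CoprodI.of l.2).prod)⁻¹ * z ≠ t) →
          (ψ (q.map fun l => CoprodI.of l.2).prod).left z = 1 := by
        intro q
        induction q with
        | nil => intro z _; simp
        | cons c q ihq =>
          intro z hz
          have e0 : z ≠ t := by simpa using hz [] List.nil_prefix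
          have e1 : (φ (CoprodI.of c.2))⁻¹ * z ≠ t := by
            simpa using hz [c] (by simp)
          have e2 := ihq ((φ (CoprodI.of c.2))⁻¹ * z) (by
            intro p hp
            have := hz (c :: p) (by simpa using hp)
            simpa [mul_assoc] using this)
          simp only [List.map_cons, List.prod_cons, map_mul, mul_left, Pi.mul_apply, hψ1, hψ2, e2]
          simp [Pi.mulSingle_eq_of_ne e0, Pi.mulSingle_eq_of_ne e1]
      refine ⟨RegularWreathProduct X Y, inferInstance, ψ, rc_wreath hK X Y hX hY, ?_⟩
      intro q hq hqn h
      rcases List.prefix_cons_iff.1 hq with rfl | ⟨q, rfl, hq2⟩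
      · exact hqn rfl
      apply hx
      have e1 : (φ (CoprodI.of b.2))⁻¹ * t ≠ t := by
        have := hφ [b] (by simp) (by simp)
        simpa using this
      have e2 := tail q ((φ (CoprodI.of b.2))⁻¹ * t) (by
        intro p hp
        have := hφ (b :: p) (by simpa using hp.trans hq2) (by simp)
        intro h'
        apply this
        rw [← mul_assoc, mul_eq_right, ← mul_inv_rev, inv_eq_one] at h'
        simpa using h')
      have h3 := congrFun (congrArg RegularWreathProduct.left h) 1
      simp only [List.map_cons, List.prod_cons, map_mul, mul_left, Pi.mul_apply, hψ1, hψ2,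
        if_neg hab, mul_one, one_mul, if_true] at h3
      change (Pi.mulSingle t x : Y → X) t * ((Pi.mulSingle t x : Y → X) _)⁻¹ *
        (ψ (q.map fun l => CoprodI.of l.2).prod).left ((φ (CoprodI.of b.2))⁻¹ * t) = 1 at h3
      rw [e2, Pi.mulSingle_eq_same] at h3
      have e3 : (Pi.mulSingle t x : Y → X) ((φ (CoprodI.of b.2))⁻¹ * t) = 1 :=
        Pi.mulSingle_eq_of_ne e1 _
      rw [show (φ (CoprodI.of a.2))⁻¹ = t from rfl] at h3
      simpa [e3] using h3

/-- Theorem 2: the free product (coproduct) of any family of `K`-residual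
groups is `K`-residual, for a root class `K`. -/
theorem coprodI_kResidual (K : GroupClass.{u}) (hK : IsRootClass K)
    (ι : Type u) (G : ι → Type u) [∀ i, Group (G i)]
    (hG : ∀ i, KResidual K (G i)) : KResidual K (Monoid.CoprodI G) := by
  classical
  intro g hg
  obtain ⟨w, rfl⟩ : ∃ w : Monoid.CoprodI.Word G, w.prod = g :=
    ⟨Monoid.CoprodI.Word.equiv g, Monoid.CoprodI.Word.equiv.symm_apply_apply g⟩
  obtain ⟨Y, _, φ, hY, hφ⟩ := rc_words hK ι G hG w.toList w.ne_one w.chain_ne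
  refine ⟨φ.ker, inferInstance, ?_, ?_⟩
  · exact hK.1 _ _ (QuotientGroup.quotientKerEquivRange φ).symm (hK.2.2.1 Y hY φ.range)
  · intro h
    refine hφ w.toList List.prefix_rfl ?_ h
    intro hn
    apply hg
    simp [Monoid.CoprodI.Word.prod, hn]
end

section
/- Theorem 3: Let 𝒦 be a root class, let A and B be groups with a common subgroup realized by injective homomorphisms i : H → A and j : H → B from a group H, and let G be the generalized free product of A and B amalgamating H (the amalgamated free product, i.e. the pushout of i and j in the category of groups). If A and B are 𝒦-residual and there exists a group G' in 𝒦 and a homomorphism φ : G → G' whose restriction to the (canonical image of the) subgroup H is injective, then G is 𝒦-residual. -/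
open Pointwise

universe u

/-- The two-element family of groups `A`, `B` indexed by `Bool`. -/
def boolFam (A B : Type u) : Bool → Type u := fun b => Bool.rec B A b

instance boolFamGroup (A B : Type u) [Group A] [Group B] : ∀ b, Group (boolFam A B b)
  | true => ‹Group A›
  | false => ‹Group B›

/-- The pair of homomorphisms `i : H →* A`, `j : H →* B` as a family over `Bool`;
the pushout of this family is the amalgamated free product of `A` and `B` over `H`. -/
def boolHoms {H A B : Type u} [Group H] [Group A] [Group B]
    (i : H →* A) (j : H →* B) : ∀ b : Bool, H →* boolFam A B b
  | true => i
  | false => j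

theorem root_wreath {K : GroupClass.{u}} (hK : IsRootClass K) (D Q : Type u) [Group D] [Group Q]
    (hD : K D) (hQ : K Q) : K (D ≀ᵣ Q) := by
  obtain ⟨hiso, -, -, -, hroot⟩ := hK
  let N : Subgroup (D ≀ᵣ Q) := (RegularWreathProduct.rightHom (D := D) (Q := Q)).ker
  have hN : ∀ x : N, x.1.right = 1 := fun x => x.2
  let e : N →* D :=
    { toFun := fun x => x.1.left 1
      map_one' := rfl
      map_mul' := fun x y => by simp [hN] }
  have he : Function.Surjective e := fun d => ⟨⟨⟨fun _ => d, 1⟩, rfl⟩, rfl⟩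
  have hr : Function.Surjective (RegularWreathProduct.rightHom (D := D) (Q := Q)) :=
    fun q => ⟨⟨1, q⟩, rfl⟩
  obtain ⟨E, hE, hle, hKE⟩ := hroot (D ≀ᵣ Q) N e.ker
    (hiso _ _ (QuotientGroup.quotientKerEquivOfSurjective _ hr).symm hQ)
    (hiso _ _ (QuotientGroup.quotientKerEquivOfSurjective _ he).symm hD)
  have hbot : E = ⊥ := by
    rw [eq_bot_iff]
    intro x hx
    have key : ∀ y ∈ E, y.right = 1 ∧ y.left 1 = 1 := by
      intro y hy
      obtain ⟨z, hz, rfl⟩ := hle hy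
      exact ⟨hN z, hz⟩
    rw [Subgroup.mem_bot]
    ext q
    · have h2 := (key _ (hE.conj_mem x hx (⟨1, q⁻¹⟩ : D ≀ᵣ Q))).2
      simpa [RegularWreathProduct.mul_def] using h2
    · exact (key x hx).1
  subst hbot
  exact hiso _ _ QuotientGroup.quotientBot hKE

section aux

open Monoid

variable {H : Type u} [Group H] {X : Bool → Type u} [∀ b, Group (X b)] (φ : ∀ b, H →* X b)

/-- Separability of an element from the base subgroup by a map to a `K`-group. -/
def SepBase (K : GroupClass.{u}) (g : PushoutI φ) : Prop :=
  ∃ (Q : Type u) (_ : Group Q), K Q ∧ ∃ ψ : PushoutI φ →* Q, ∀ h, ψ g ≠ ψ (PushoutI.base φ h)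

/-- Alternating words. -/
inductive Red : Bool → PushoutI φ → Prop
  | single (b : Bool) (a : X b) (ha : a ∉ (φ b).range) : Red b (PushoutI.of b a)
  | cons (b : Bool) (a : X b) (ha : a ∉ (φ b).range) (y : PushoutI φ) (hy : Red (!b) y) :
      Red b (PushoutI.of b a * y)

theorem red_base_mul (h : H) {b : Bool} {y : PushoutI φ} (hy : Red φ b y) :
    Red φ b (PushoutI.base φ h * y) := by
  have key : ∀ a : X b, a ∉ (φ b).range → φ b h * a ∉ (φ b).range := by
    intro a ha h'
    exact ha ((Subgroup.mul_mem_cancel_left (φ b).range (MonoidHom.mem_range.2 ⟨h, rfl⟩)).1 h')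
  cases hy with
  | single _ a ha =>
    rw [← PushoutI.of_apply_eq_base φ b, ← map_mul]
    exact Red.single b _ (key a ha)
  | cons _ a ha y hy =>
    rw [← PushoutI.of_apply_eq_base φ b, ← mul_assoc, ← map_mul]
    exact Red.cons b _ (key a ha) _ hy

theorem red_cases (g : PushoutI φ) : (∃ h, g = PushoutI.base φ h) ∨ ∃ b, Red φ b g := by
  let P : PushoutI φ → Prop := fun g => (∃ h, g = PushoutI.base φ h) ∨ ∃ b, Red φ b g
  have hb : ∀ h y, P y → P (PushoutI.base φ h * y) := by
    rintro h y (⟨h', rfl⟩ | ⟨b, hy⟩)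
    · exact Or.inl ⟨h * h', (map_mul _ _ _).symm⟩
    · exact Or.inr ⟨b, red_base_mul φ h hy⟩
  have hof : ∀ b (a : X b), P (PushoutI.of b a) := by
    intro b a
    by_cases ha : a ∈ (φ b).range
    · obtain ⟨h, rfl⟩ := ha
      exact Or.inl ⟨h, PushoutI.of_apply_eq_base φ b h⟩
    · exact Or.inr ⟨b, Red.single b a ha⟩
  have main : ∀ g : PushoutI φ, ∀ y, P y → P (g * y) := by
    intro g
    induction g using PushoutI.induction_on with
    | of b a =>
      have hmul : ∀ (a : X b) (y), Red φ (!b) y → P (PushoutI.of b a * y) := by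
        intro a y hy
        by_cases ha : a ∈ (φ b).range
        · obtain ⟨h, rfl⟩ := ha
          rw [PushoutI.of_apply_eq_base]
          exact hb _ _ (Or.inr ⟨_, hy⟩)
        · exact Or.inr ⟨b, Red.cons b a ha y hy⟩
      rintro y (⟨h, rfl⟩ | ⟨b', hy⟩)
      · rw [← PushoutI.of_apply_eq_base φ b, ← map_mul]
        exact hof _ _
      · by_cases hbb : b' = b
        · subst hbb
          cases hy with
          | single _ a' ha' => rw [← map_mul]; exact hof _ _
          | cons _ a' ha' y hy => rw [← mul_assoc, ← map_mul]; exact hmul _ _ hy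
        · obtain rfl : b' = !b := by cases b <;> cases b' <;> simp_all
          exact hmul _ _ hy
    | base h => exact hb h
    | mul x y hx hy => intro z hz; rw [mul_assoc]; exact hx _ (hy _ hz)
  have := main g 1 (Or.inl ⟨1, (map_one _).symm⟩)
  rwa [mul_one] at this

/-- One step of a path. -/
def Step (b : Bool) (g g' : PushoutI φ) : Prop :=
  ∃ a : X b, a ∉ (φ b).range ∧ g⁻¹ * g' = PushoutI.of b a

theorem red_path {b : Bool} {g : PushoutI φ} (hg : Red φ b g) :
    ∃ (n : ℕ) (p : ℕ → PushoutI φ) (c : ℕ → Bool), 0 < n ∧ p 0 = 1 ∧ p n = g ∧ c 0 = b ∧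
      (∀ k, c (k + 1) = !(c k)) ∧ ∀ k, k < n → Step φ (c k) (p k) (p (k + 1)) := by
  induction hg with
  | single b a ha =>
    refine ⟨1, fun k => if k = 0 then 1 else PushoutI.of b a, fun k => Nat.rec b (fun _ x => !x) k,
      one_pos, by simp, by simp, rfl, fun _ => rfl, ?_⟩
    intro k hk
    obtain rfl : k = 0 := by omega
    exact ⟨a, ha, by simp⟩
  | cons b a ha y hy ih =>
    obtain ⟨n, p, c, hn, h0, hpn, hc0, hc, hs⟩ := ih
    refine ⟨n + 1, fun k => Nat.casesOn k 1 (fun m => PushoutI.of b a * p m),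
      fun k => Nat.casesOn k b c, by omega, rfl, by simp [hpn], rfl, ?_, ?_⟩
    · rintro (_ | k)
      · exact hc0
      · exact hc k
    · rintro (_ | k) hk
      · exact ⟨a, ha, by simp [h0]⟩
      · obtain ⟨a', ha', h'⟩ := hs k (by omega)
        exact ⟨a', ha', by simp [← h', mul_assoc]⟩

theorem twist {D Q : Type u} [Group D] [Group Q] (ψ : PushoutI φ →* Q) (b : Bool)
    (α : X b →* D ≀ᵣ Q)
    (hα : ∀ h, α (φ b h) = RegularWreathProduct.inl (ψ (PushoutI.base φ h))) :
    ∃ ψ' : PushoutI φ →* D ≀ᵣ Q, (∀ a, ψ' (PushoutI.of b a) = α a) ∧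
      (∀ b', b' ≠ b → ∀ a, ψ' (PushoutI.of b' a) = RegularWreathProduct.inl (ψ (PushoutI.of b' a)))
      ∧ (∀ h, ψ' (PushoutI.base φ h) = RegularWreathProduct.inl (ψ (PushoutI.base φ h))) := by
  refine ⟨PushoutI.lift (Function.update
    (fun b' => (RegularWreathProduct.inl.comp (ψ.comp (PushoutI.of b')) : X b' →* D ≀ᵣ Q)) b α)
    (RegularWreathProduct.inl.comp (ψ.comp (PushoutI.base φ))) ?_, ?_, ?_, ?_⟩
  · intro b'
    by_cases h : b' = b
    · subst h
      ext1 x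
      simp [hα]
    · ext1 x
      simp [Function.update_of_ne h, PushoutI.of_apply_eq_base]
  · intro a; simp
  · intro b' h a; simp [Function.update_of_ne h]
  · intro h; simp

theorem sep_of {K : GroupClass.{u}} (hK : IsRootClass K) (hX : ∀ b, KResidual K (X b))
    {Q : Type u} [Group Q] (hQ : K Q) (ψ : PushoutI φ →* Q)
    (hψ : Function.Injective fun h => ψ (PushoutI.base φ h))
    (b : Bool) (a : X b) (ha : a ∉ (φ b).range) : SepBase φ K (PushoutI.of b a) := by
  by_cases hsep : ∀ h, ψ (PushoutI.of b a) ≠ ψ (PushoutI.base φ h)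
  · exact ⟨Q, _, hQ, ψ, hsep⟩
  push Not at hsep
  obtain ⟨h₀, hh₀⟩ := hsep
  obtain ⟨M, hM, hKM, haM⟩ := hX b ((φ b h₀)⁻¹ * a) (by
    intro h; exact ha ⟨h₀, inv_mul_eq_one.1 h⟩)
  let R : Subgroup Q := (ψ.comp (PushoutI.base φ)).range
  have hr : ∀ q : Q, ∃ h : H, ψ (PushoutI.base φ h) *
      (Quotient.out (Quotient.mk (QuotientGroup.rightRel R) q)) = q := by
    intro q
    have h1 := Quotient.mk_out (s := QuotientGroup.rightRel R) q
    have h2 := QuotientGroup.rightRel_apply.1 h1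
    obtain ⟨h, hh⟩ := h2
    refine ⟨h, ?_⟩
    have hh' : ψ (PushoutI.base φ h) = _ := hh
    rw [hh']; simp
  choose t ht using hr
  have ht' : ∀ h q, t (ψ (PushoutI.base φ h) * q) = h * t q := by
    intro h q
    have hq : Quotient.mk (QuotientGroup.rightRel R) (ψ (PushoutI.base φ h) * q) =
        Quotient.mk (QuotientGroup.rightRel R) q := by
      apply Quotient.sound
      apply QuotientGroup.rightRel_apply.2
      refine ⟨h⁻¹, ?_⟩
      simp
    have h1 := ht (ψ (PushoutI.base φ h) * q)
    rw [hq] at h1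
    apply hψ
    show ψ _ = ψ _
    apply mul_right_cancel (b := Quotient.out (Quotient.mk (QuotientGroup.rightRel R) q))
    rw [h1, map_mul, map_mul, mul_assoc, ht]
  let τ : Q → X b ⧸ M := fun q => ((φ b (t q) : X b) : X b ⧸ M)
  let α : X b →* (X b ⧸ M) ≀ᵣ Q :=
    { toFun := fun x => ⟨fun q => (τ q)⁻¹ * (x : X b ⧸ M) * τ ((ψ (PushoutI.of b x))⁻¹ * q),
        ψ (PushoutI.of b x)⟩
      map_one' := by ext <;> simp
      map_mul' := fun x y => by ext <;> simp [mul_assoc] }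
  obtain ⟨ψ', h1, -, h3⟩ := twist φ ψ b α (by
    intro h
    ext q
    · simp only [α, τ, MonoidHom.coe_mk, OneHom.coe_mk, RegularWreathProduct.left_inl,
        PushoutI.of_apply_eq_base]
      rw [← map_inv ψ, ← map_inv (PushoutI.base φ), ht']
      simp
    · simp [α, PushoutI.of_apply_eq_base])
  refine ⟨_, _, root_wreath hK _ Q hKM hQ, ψ', ?_⟩
  intro h heq
  rw [h1, h3] at heq
  have e2 : ψ (PushoutI.of b a) = ψ (PushoutI.base φ h) :=
    congrArg RegularWreathProduct.right heq
  obtain rfl : h₀ = h := hψ (hh₀.symm.trans e2)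
  have e1 := congrFun (congrArg RegularWreathProduct.left heq) 1
  simp only [α, τ, MonoidHom.coe_mk, OneHom.coe_mk, RegularWreathProduct.left_inl] at e1
  rw [hh₀, ← map_inv ψ, ← map_inv (PushoutI.base φ), ht'] at e1
  apply haM
  rw [← QuotientGroup.eq_one_iff]
  simp only [map_mul, map_inv, QuotientGroup.mk_mul, QuotientGroup.mk_inv, Pi.one_apply] at e1 ⊢
  have e3 : ((a : X b) : X b ⧸ M) * ((φ b h₀ : X b) : X b ⧸ M)⁻¹ = 1 := by
    rw [mul_assoc, inv_mul_eq_one, ← mul_assoc] at e1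
    simpa using e1.symm
  rw [mul_inv_eq_one] at e3
  rw [e3]; simp

theorem sep_finite {K : GroupClass.{u}} (hK : IsRootClass K) (Q₀ : Type u) [Group Q₀] (hQ₀ : K Q₀)
    (s : Finset (ℕ × ℕ)) (p : ℕ × ℕ → PushoutI φ) (hs : ∀ x ∈ s, SepBase φ K (p x)) :
    ∃ (Q : Type u) (_ : Group Q), K Q ∧ ∃ ψ : PushoutI φ →* Q,
      ∀ x ∈ s, ∀ h, ψ (p x) ≠ ψ (PushoutI.base φ h) := by
  classical
  induction s using Finset.induction_on with
  | empty => exact ⟨Q₀, _, hQ₀, 1, by simp⟩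
  | insert x s hx ih =>
    obtain ⟨Q₁, _, hQ₁, ψ₁, h₁⟩ := ih (fun y hy => hs y (Finset.mem_insert_of_mem hy))
    obtain ⟨Q₂, _, hQ₂, ψ₂, h₂⟩ := hs x (Finset.mem_insert_self _ _)
    refine ⟨Q₁ × Q₂, inferInstance, hK.2.2.2.1 _ _ hQ₁ hQ₂, ψ₁.prod ψ₂, ?_⟩
    intro y hy h heq
    rcases Finset.mem_insert.1 hy with rfl | hy
    · exact h₂ h (congrArg Prod.snd heq)
    · exact h₁ y hy h (congrArg Prod.fst heq)

theorem sep_path {K : GroupClass.{u}} (hK : IsRootClass K)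
    (hof : ∀ b (a : X b), a ∉ (φ b).range → SepBase φ K (PushoutI.of b a))
    (p : ℕ → PushoutI φ) (c : ℕ → Bool) (hc : ∀ k, c (k + 1) = !(c k)) (n : ℕ) :
    ∀ i j, i < j → j - i ≤ n → (∀ k, i ≤ k → k < j → Step φ (c k) (p k) (p (k + 1))) →
      SepBase φ K ((p i)⁻¹ * p j) := by
  classical
  induction n with
  | zero => intro i j h1 h2; omega
  | succ n ih =>
    intro i j hij hn hstep
    by_cases hj : j = i + 1
    · subst hj
      obtain ⟨a, ha, h⟩ := hstep i le_rfl hij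
      rw [h]; exact hof _ a ha
    obtain ⟨D, _, hDn, hD⟩ := hK.2.1
    obtain ⟨x, hx⟩ := exists_ne (1 : D)
    obtain ⟨Q, _, hQ, ψ, hψ⟩ := sep_finite φ hK D hD
      ((Finset.range (j + 1) ×ˢ Finset.range (j + 1)).filter
        (fun y => i ≤ y.1 ∧ y.1 < y.2 ∧ y.2 - y.1 ≤ n)) (fun y => (p y.1)⁻¹ * p y.2) (by
          rintro ⟨k, l⟩ hkl
          simp only [Finset.mem_filter, Finset.mem_product, Finset.mem_range] at hkl
          exact ih k l hkl.2.2.1 hkl.2.2.2 (fun m hm hm' => hstep m (by omega) (by omega)))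
    have hψ' : ∀ k l, i ≤ k → k < l → l ≤ j → l - k ≤ n →
        ψ ((p k)⁻¹ * p l) ∉ (ψ.comp (PushoutI.base φ)).range := by
      rintro k l h1 h2 h3 h4 ⟨h, hh⟩
      refine hψ (k, l) ?_ h hh.symm
      simp only [Finset.mem_filter, Finset.mem_product, Finset.mem_range]
      omega
    set R : Subgroup Q := (ψ.comp (PushoutI.base φ)).range with hR
    have hψ'' : ∀ k l, i ≤ k → k < l → l ≤ j → l - k ≤ n → ψ ((p l)⁻¹ * p k) ∉ R := by
      intro k l h1 h2 h3 h4 h5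
      apply hψ' k l h1 h2 h3 h4
      have := R.inv_mem h5
      rwa [← map_inv, mul_inv_rev, inv_inv] at this
    let f : Q → D := fun q => if q ∈ R then x else 1
    have f1 : ∀ q, q ∈ R → f q = x := fun q hq => if_pos hq
    have f0 : ∀ q, q ∉ R → f q = 1 := fun q hq => if_neg hq
    have fR : ∀ r ∈ R, ∀ q, f (r * q) = f q := by
      intro r hr q
      simp only [f, Subgroup.mul_mem_cancel_left R hr]
    let F : D ≀ᵣ Q := ⟨f, 1⟩
    let α : X true →* D ≀ᵣ Q := (MulAut.conj F).toMonoidHom.comp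
      (RegularWreathProduct.inl.comp (ψ.comp (PushoutI.of true)))
    have hα : ∀ a, α a = ⟨fun q => f q * (f ((ψ (PushoutI.of true a))⁻¹ * q))⁻¹,
        ψ (PushoutI.of true a)⟩ := by
      intro a
      ext q <;> simp [α, F]
    obtain ⟨ψ', h1, h2, h3⟩ := twist φ ψ true α (by
      intro h
      rw [hα]
      have hm : (ψ (PushoutI.base φ h))⁻¹ ∈ R := R.inv_mem ⟨h, rfl⟩
      ext q
      · simp [PushoutI.of_apply_eq_base, fR _ hm]
      · simp [PushoutI.of_apply_eq_base])
    have hright : ∀ g, (ψ' g).right = ψ g := by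
      intro g
      induction g using PushoutI.induction_on with
      | of b a =>
        cases b
        · rw [h2 _ (by simp)]; rfl
        · rw [h1, hα]
      | base h => rw [h3]; rfl
      | mul x y hx hy => rw [map_mul, RegularWreathProduct.mul_right, hx, hy, map_mul]
    refine ⟨_, _, root_wreath hK D Q hD hQ, ψ', ?_⟩
    intro h heq
    rw [h3] at heq
    set y : Q := ψ ((p i)⁻¹ * p (i + 1)) with hy
    -- the value of the left component along the path
    have hrec : ∀ m, i ≤ m → m < j → (ψ' ((p i)⁻¹ * p (m + 1))).left y =
        (ψ' ((p i)⁻¹ * p m)).left y * (if c m = true then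
          f (ψ ((p m)⁻¹ * p (i + 1))) * (f (ψ ((p (m + 1))⁻¹ * p (i + 1))))⁻¹ else 1) := by
      intro m hm hm'
      have e : (p i)⁻¹ * p (m + 1) = ((p i)⁻¹ * p m) * ((p m)⁻¹ * p (m + 1)) := by group
      have e2 : (ψ ((p i)⁻¹ * p m))⁻¹ * y = ψ ((p m)⁻¹ * p (i + 1)) := by
        rw [hy, ← map_inv, ← map_mul]; congr 1; group
      have e3 : (ψ ((p m)⁻¹ * p (m + 1)))⁻¹ * ψ ((p m)⁻¹ * p (i + 1)) =
          ψ ((p (m + 1))⁻¹ * p (i + 1)) := by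
        rw [← map_inv, ← map_mul]; congr 1; group
      rw [e, map_mul, RegularWreathProduct.mul_left, Pi.mul_apply, hright, e2]
      congr 1
      obtain ⟨a, -, hs⟩ := hstep m hm hm'
      rw [← e3, hs]
      revert a
      cases c m
      · intro a hs
        rw [h2 _ (by simp)]; simp
      · intro a hs
        rw [h1, hα]; simp
    have hone : f (ψ ((p (i + 1))⁻¹ * p (i + 1))) = x := f1 _ (by simp [R.one_mem])
    have hzero : ∀ m, i ≤ m → m ≤ j → m ≠ i + 1 → f (ψ ((p m)⁻¹ * p (i + 1))) = 1 := by
      intro m hm hm' hne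
      apply f0
      rcases Nat.lt_or_gt_of_ne hne with hlt | hlt
      · exact hψ' m (i + 1) hm hlt (by omega) (by omega)
      · exact hψ'' (i + 1) m (by omega) hlt hm' (by omega)
    have hne : ∀ m, i + 2 ≤ m → m ≤ j → (ψ' ((p i)⁻¹ * p m)).left y ≠ 1 := by
      intro m hm
      induction m, hm using Nat.le_induction with
      | base =>
        intro hj2
        rw [hrec (i + 1) (by omega) (by omega), hrec i le_rfl (by omega), hone,
          hzero i le_rfl (by omega) (by omega), hzero (i + 1 + 1) (by omega) (by omega) (by omega),
          hc i]
        cases c i <;> simp [hx]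
      | succ m hm ihm =>
        intro hj2
        rw [hrec m (by omega) (by omega), hzero m (by omega) (by omega) (by omega),
          hzero (m + 1) (by omega) (by omega) (by omega)]
        simpa using ihm (by omega)
    apply hne j (by omega) le_rfl
    rw [heq]; rfl

theorem pushout_residual {K : GroupClass.{u}} (hK : IsRootClass K) (hX : ∀ b, KResidual K (X b))
    (hinj : ∀ b, Function.Injective (φ b))
    {Q : Type u} [Group Q] (hQ : K Q) (ψ : PushoutI φ →* Q)
    (hψ : Set.InjOn ψ (Set.range (PushoutI.base φ))) : KResidual K (PushoutI φ) := by
  have hψi : Function.Injective fun h => ψ (PushoutI.base φ h) := by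
    intro h h' e
    exact PushoutI.base_injective hinj (hψ ⟨h, rfl⟩ ⟨h', rfl⟩ e)
  intro g hg
  have key : ∃ (Q : Type u) (_ : Group Q), K Q ∧ ∃ ψ : PushoutI φ →* Q, ψ g ≠ 1 := by
    rcases red_cases φ g with ⟨h, rfl⟩ | ⟨b, hb⟩
    · refine ⟨Q, _, hQ, ψ, fun e => hg ?_⟩
      exact hψ ⟨h, rfl⟩ ⟨1, map_one _⟩ (e.trans (map_one ψ).symm)
    · obtain ⟨n, p, c, hn, h0, hpn, -, hc, hs⟩ := red_path φ hb
      have := sep_path φ hK (sep_of φ hK hX hQ ψ hψi) p c hc n 0 n hn (by omega)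
        (fun k _ hk => hs k hk)
      rw [h0, hpn, inv_one, one_mul] at this
      obtain ⟨Q', _, hQ', ψ', h'⟩ := this
      exact ⟨Q', _, hQ', ψ', by simpa using h' 1⟩
  obtain ⟨Q', _, hQ', ψ', h'⟩ := key
  refine ⟨ψ'.ker, inferInstance, ?_, h'⟩
  exact hK.1 _ _ (QuotientGroup.quotientKerEquivRange ψ').symm (hK.2.2.1 _ hQ' _)

end aux

/-- Theorem 3: let `G` be the amalgamated free product (pushout) of groups
`A` and `B` over a common subgroup `H` (realized by injective homomorphisms `i`, `j`).
If `A` and `B` are `K`-residual and there is a homomorphism from `G` to a group of the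
root class `K` that is injective on the canonical image of `H`, then `G` is `K`-residual. -/
theorem amalgamated_product_kResidual (K : GroupClass.{u}) (hK : IsRootClass K)
    (H A B : Type u) [Group H] [Group A] [Group B]
    (i : H →* A) (j : H →* B)
    (hi : Function.Injective i) (hj : Function.Injective j)
    (hA : KResidual K A) (hB : KResidual K B)
    (hφ : ∃ (G' : Type u) (_ : Group G'), K G' ∧
      ∃ φ : Monoid.PushoutI (boolHoms i j) →* G',
        Set.InjOn φ (Set.range (Monoid.PushoutI.base (boolHoms i j)))) :
    KResidual K (Monoid.PushoutI (boolHoms i j)) := by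
  obtain ⟨G', _, hG', ψ, hψ⟩ := hφ
  refine pushout_residual (boolHoms i j) hK ?_ ?_ hG' ψ hψ
  · rintro (_ | _)
    · exact hB
    · exact hA
  · rintro (_ | _)
    · exact hj
    · exact hi
end

section
/- If 𝒦 is a root class, A is a group belonging to 𝒦, and H is a subgroup of A, then the generalized free square Q = A *_H A (the amalgamated free product of two copies of A amalgamating H via the identity map, i.e. the pushout of two copies of the inclusion H → A) is 𝒦-residual. -/
open Pointwise

universe u

section Helpers

/-- Quotients by kernels of homs into members of the class. -/
lemma rc_ker {K : GroupClass.{u}} (hK : IsRootClass K) {G B : Type u} [Group G] [Group B]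
    (hB : K B) (f : G →* B) : K (G ⧸ f.ker) :=
  hK.1 _ _ (QuotientGroup.quotientKerEquivRange f).symm (hK.2.2.1 B hB f.range)

lemma rc_step {K : GroupClass.{u}} (hK : IsRootClass K) {G B : Type u} [Group G] [Group B]
    (hB : K B) (D : Subgroup G) (hD : D.Normal) (hGD : letI := hD; K (G ⧸ D)) (f : D →* B) :
    ∃ (D' : Subgroup G) (hD' : D'.Normal), (letI := hD'; K (G ⧸ D')) ∧
      ∀ d ∈ D', ∃ h : d ∈ D, f ⟨d, h⟩ = 1 := by
  obtain ⟨E, hE, hle, hKE⟩ := hK.2.2.2.2 G D f.ker hGD (rc_ker hK hB f)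
  refine ⟨E, hE, hKE, fun d hd => ?_⟩
  obtain ⟨y, hy, rfl⟩ := hle hd
  exact ⟨y.2, hy⟩

lemma rc_top {K : GroupClass.{u}} (hK : IsRootClass K) (G : Type u) [Group G] :
    K (G ⧸ (⊤ : Subgroup G)) := by
  obtain ⟨X, _, -, hX⟩ := hK.2.1
  have h1 : K (⊥ : Subgroup X) := hK.2.2.1 X hX ⊥
  have h2 := rc_ker hK h1 (1 : G →* (⊥ : Subgroup X))
  have h3 : ((1 : G →* (⊥ : Subgroup X))).ker = ⊤ := by
    ext; simp [MonoidHom.mem_ker]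
  exact hK.1 _ _ (QuotientGroup.quotientMulEquivOfEq h3) h2

/-- The infinite cyclic group in universe `u`. -/
abbrev ZZ : Type u := ULift.{u} (Multiplicative ℤ)

def zz (n : ℤ) : ZZ.{u} := ULift.up (Multiplicative.ofAdd n)

lemma zz_res {K : GroupClass.{u}} (hK : IsRootClass K) (k : ℕ) : ∀ n : ℤ, n ≠ 0 → n.natAbs ≤ k →
    ∃ D : Subgroup ZZ.{u}, K (ZZ.{u} ⧸ D) ∧ zz n ∉ D := by
  induction k with
  | zero => intro n hn h; omega
  | succ k ih =>
    intro n hn h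
    obtain ⟨X, _, hnt, hX⟩ := hK.2.1
    obtain ⟨x, hx⟩ := exists_ne (1 : X)
    let f : ZZ.{u} →* X := (zpowersHom X x).comp (MulEquiv.ulift.toMonoidHom)
    have hf : ∀ z : ZZ.{u}, f z = x ^ (Multiplicative.toAdd z.down) := fun z => rfl
    by_cases hfn : zz n ∈ f.ker
    · have hmem : ∀ z : ZZ.{u}, z ∈ f.ker ↔ (orderOf x : ℤ) ∣ Multiplicative.toAdd z.down := by
        intro z
        rw [MonoidHom.mem_ker, hf, orderOf_dvd_iff_zpow_eq_one]
      have hdn : (orderOf x : ℤ) ∣ n := (hmem _).1 hfn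
      obtain ⟨n', hn'⟩ := hdn
      have hd1 : orderOf x ≠ 1 := by rwa [Ne, orderOf_eq_one_iff]
      have hd0 : orderOf x ≠ 0 := by
        intro h0; rw [h0] at hn'; simp at hn'; exact hn hn'
      have hn0 : n' ≠ 0 := by rintro rfl; simp at hn'; exact hn hn'
      have hle : n'.natAbs ≤ k := by
        have : n.natAbs = orderOf x * n'.natAbs := by
          rw [hn', Int.natAbs_mul, Int.natAbs_natCast]
        have h2 : 2 ≤ orderOf x := by omega
        have h3 : 0 < n'.natAbs := Int.natAbs_pos.2 hn0
        nlinarith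
      obtain ⟨D, hD, hnD⟩ := ih n' hn0 hle
      let g : f.ker →* ZZ.{u} ⧸ D :=
        { toFun := fun z => QuotientGroup.mk (zz (Multiplicative.toAdd z.1.down / (orderOf x : ℤ)))
          map_one' := by
            simp; exact D.one_mem
          map_mul' := by
            rintro ⟨a, ha⟩ ⟨b, hb⟩
            rw [← QuotientGroup.mk_mul]
            congr 1
            have := Int.add_ediv_of_dvd_left (b := Multiplicative.toAdd b.down) ((hmem a).1 ha)
            change zz ((Multiplicative.toAdd a.down + Multiplicative.toAdd b.down) / _) = _
            rw [this]; rfl }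
      obtain ⟨D', hD', hKD', hh⟩ := rc_step hK hD f.ker inferInstance (rc_ker hK hX f) g
      refine ⟨D', hKD', fun hmm => ?_⟩
      obtain ⟨h1, h2⟩ := hh _ hmm
      apply hnD
      rw [← QuotientGroup.eq_one_iff]
      rw [← h2]
      change _ = QuotientGroup.mk (zz (n / (orderOf x : ℤ)))
      rw [hn', Int.mul_ediv_cancel_left _ (by exact_mod_cast hd0)]
    · exact ⟨f.ker, rc_ker hK hX f, hfn⟩

lemma exists_commB {K : GroupClass.{u}} (hK : IsRootClass K) (n : ℤ) (hn : n ≠ 0) :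
    ∃ (B : Type u) (_ : CommGroup B) (b : B), K B ∧ b ^ n ≠ 1 := by
  obtain ⟨D, hD, h⟩ := zz_res hK _ n hn le_rfl
  refine ⟨ZZ.{u} ⧸ D, inferInstance, QuotientGroup.mk (zz 1), hD, fun h1 => h ?_⟩
  rw [← QuotientGroup.eq_one_iff, ← h1, ← QuotientGroup.mk_zpow]
  congr 1
  have : (Multiplicative.ofAdd (1:ℤ))^n = Multiplicative.ofAdd n := by
    rw [← ofAdd_zsmul]; simp
  exact congrArg ULift.up this.symm

variable {S : Type u} {B : Type u} [CommGroup B]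

open Classical in
/-- elementary operators -/
noncomputable def opHom (c : ℕ → Option S) (hc : ∀ m x, c m = some x → c (m + 1) ≠ some x)
    (x : S) : Multiplicative ℤ →* Function.End (ℕ → B) where
  toFun e := fun v m => v m * (if c m = some x then v (m + 1) ^ (Multiplicative.toAdd e) else 1)
  map_one' := by
    funext v m; simp; rfl
  map_mul' e e' := by
    funext v m
    change _ = (v m * _) * _
    by_cases h : c m = some x
    · simp [h, hc m x h, zpow_add, mul_left_comm, mul_comm]
    · simp [h]

noncomputable def opPerm (c : ℕ → Option S) (hc : ∀ m x, c m = some x → c (m + 1) ≠ some x)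
    (x : S) : Multiplicative ℤ →* Equiv.Perm (ℕ → B) :=
  (MulAction.toPermHom (Function.End (ℕ → B))ˣ (ℕ → B)).comp ((opHom c hc x).toHomUnits) 

noncomputable def rho (c : ℕ → Option S) (hc : ∀ m x, c m = some x → c (m + 1) ≠ some x) :
    FreeGroup S →* Equiv.Perm (ℕ → B) :=
  FreeGroup.lift fun x => opPerm c hc x (Multiplicative.ofAdd 1)

open Classical in
lemma rho_zpow (c : ℕ → Option S) (hc : ∀ m x, c m = some x → c (m + 1) ≠ some x)
    (x : S) (e : ℤ) (v : ℕ → B) (m : ℕ) :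
    rho c hc (FreeGroup.of x ^ e) v m = v m * (if c m = some x then v (m + 1) ^ e else 1) := by
  have : rho (B := B) c hc (FreeGroup.of x ^ e) = opPerm c hc x (Multiplicative.ofAdd e) := by
    rw [map_zpow, rho, FreeGroup.lift_apply_of, ← map_zpow, ← ofAdd_zsmul]; simp
  rw [this]
  rfl

lemma rho_unip (c : ℕ → Option S) (hc : ∀ m x, c m = some x → c (m + 1) ≠ some x)
    (w : FreeGroup S) : ∀ (m : ℕ) (v v' : ℕ → B), (∀ i > m, v i = v' i) →
      rho c hc w v m / v m = rho c hc w v' m / v' m := by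
  have key : ∀ (x : S) (e : ℤ) (m : ℕ) (v v' : ℕ → B), (∀ i > m, v i = v' i) →
      rho c hc (FreeGroup.of x ^ e) v m / v m = rho c hc (FreeGroup.of x ^ e) v' m / v' m := by
    intro x e m v v' h
    rw [rho_zpow, rho_zpow, h (m + 1) (by omega), mul_div_cancel_left, mul_div_cancel_left]
  induction w using FreeGroup.induction_on with
  | C1 => intro m v v' h; simp
  | of x => simpa using key x 1
  | inv_of x _ => simpa using key x (-1)
  | mul a b ha hb =>
    intro m v v' h
    have hb' : ∀ i ≥ m, rho c hc b v i / v i = rho c hc b v' i / v' i := fun i hi =>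
      hb i v v' (fun j hj => h j (by omega))
    have h1 := ha m (rho c hc b v) (rho c hc b v') (fun i hi => by
      have := hb' i (by omega)
      rw [h i hi] at this
      exact div_left_injective this)
    have h2 := hb' m le_rfl
    rw [map_mul, Equiv.Perm.mul_apply, Equiv.Perm.mul_apply,
      ← div_mul_div_cancel _ (rho c hc b v m) (v m), h1, h2, div_mul_div_cancel]

lemma rho_ker {K : GroupClass.{u}} (hK : IsRootClass K) (hB : K B)
    (c : ℕ → Option S) (hc : ∀ m x, c m = some x → c (m + 1) ≠ some x)
    (v : ℕ → B) (k : ℕ) (hk : ∀ i ≥ k, c i = none) (j : ℕ) :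
    ∃ (D : Subgroup (FreeGroup S)) (hD : D.Normal), (letI := hD; K (FreeGroup S ⧸ D)) ∧
      ∀ d ∈ D, ∀ i, k ≤ i + j → rho c hc d v i = v i := by
  induction j with
  | zero =>
    refine ⟨⊤, inferInstance, rc_top hK _, fun d _ => ?_⟩
    intro i hi
    have : ∀ (d : FreeGroup S) (v : ℕ → B), rho c hc d v i = v i := by
      intro d
      have key : ∀ (x : S) (e : ℤ) (v : ℕ → B), rho c hc (FreeGroup.of x ^ e) v i = v i := by
        intro x e v
        rw [rho_zpow, hk i (by omega)]; simp
      induction d using FreeGroup.induction_on with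
      | C1 => intro v; simp
      | of x => simpa using key x 1
      | inv_of x _ => simpa using key x (-1)
      | mul a b ha hb => intro v; rw [map_mul, Equiv.Perm.mul_apply, ha, hb]
    exact this d v
  | succ j ih =>
    obtain ⟨D, hD, hKD, h⟩ := ih
    by_cases hj : k ≤ j
    · exact ⟨D, hD, hKD, fun d hd i hi => h d hd i (by omega)⟩
    let m := k - (j + 1)
    let f : D →* B :=
      { toFun := fun d => rho c hc d.1 v m / v m
        map_one' := by simp
        map_mul' := by
          rintro ⟨a, ha⟩ ⟨b, hb⟩
          have := rho_unip c hc a m (rho c hc b v) v (fun i hi => h b hb i (by omega))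
          change rho c hc (a * b) v m / v m = _
          rw [map_mul, Equiv.Perm.mul_apply, ← div_mul_div_cancel _ (rho c hc b v m) (v m), this] }
    obtain ⟨D', hD', hKD', hh⟩ := rc_step hK hB D hD hKD f
    refine ⟨D', hD', hKD', fun d hd i hi => ?_⟩
    obtain ⟨h1, h2⟩ := hh d hd
    by_cases hi' : k ≤ i + j
    · exact h d h1 i hi'
    · have : i = m := by omega
      rw [this]
      exact div_eq_one.1 h2

/-- product of syllables -/
def sylProd (L : List (S × ℤ)) : FreeGroup S := (L.map fun p => FreeGroup.of p.1 ^ p.2).prod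

def Good (L : List (S × ℤ)) : Prop :=
  (∀ p ∈ L, p.2 ≠ 0) ∧ L.IsChain (fun p q => p.1 ≠ q.1)

lemma syl_step (x : S) (e : ℤ) (L : List (S × ℤ)) (hL : Good L) :
    ∃ L', Good L' ∧ sylProd L' = FreeGroup.of x ^ e * sylProd L := by
  by_cases he : e = 0
  · exact ⟨L, hL, by simp [he]⟩
  cases L with
  | nil => exact ⟨[(x, e)], by simp [Good, he], by simp [sylProd]⟩
  | cons p L =>
    obtain ⟨y, e'⟩ := p
    by_cases hxy : x = y
    · subst hxy
      by_cases hs : e + e' = 0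
      · refine ⟨L, ⟨fun p hp => hL.1 p (by simp [hp]), hL.2.tail⟩, ?_⟩
        simp only [sylProd, List.map_cons, List.prod_cons]
        rw [← mul_assoc, ← zpow_add, hs]; simp
      · refine ⟨(x, e + e') :: L, ⟨?_, ?_⟩, ?_⟩
        · intro p hp
          rcases List.mem_cons.1 hp with rfl | hp
          · exact hs
          · exact hL.1 p (by simp [hp])
        · have := hL.2
          rw [List.isChain_cons] at this ⊢
          exact this
        · simp only [sylProd, List.map_cons, List.prod_cons]
          rw [← mul_assoc, ← zpow_add]
    · refine ⟨(x, e) :: (y, e') :: L, ⟨?_, ?_⟩, by simp [sylProd]⟩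
      · intro p hp
        rcases List.mem_cons.1 hp with rfl | hp
        · exact he
        · exact hL.1 p hp
      · rw [List.isChain_cons_cons]; exact ⟨hxy, hL.2⟩

lemma syl_exists (g : FreeGroup S) : ∃ L, Good L ∧ sylProd L = g := by
  have : ∀ L, Good L → ∃ L', Good L' ∧ sylProd L' = g * sylProd L := by
    induction g using FreeGroup.induction_on with
    | C1 => exact fun L hL => ⟨L, hL, by simp⟩
    | of x => simpa using syl_step x 1
    | inv_of x _ => simpa using syl_step x (-1)
    | mul a b ha hb =>
      intro L hL
      obtain ⟨L1, h1, h1'⟩ := hb L hL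
      obtain ⟨L2, h2, h2'⟩ := ha L1 h1
      exact ⟨L2, h2, by rw [h2', h1', mul_assoc]⟩
  obtain ⟨L, h, h'⟩ := this [] (by simp [Good])
  exact ⟨L, h, by simpa [sylProd] using h'⟩

lemma rho_syl (c : ℕ → Option S) (hc : ∀ m x, c m = some x → c (m + 1) ≠ some x)
    (b : B) (v : ℕ → B) (L : List (S × ℤ)) : ∀ j : ℕ,
    (∀ i (h : i < L.length), c (j + i) = some (L[i]).1) → v (j + L.length) = b →
    (∀ i < j + L.length, v i = 1) →
    rho c hc (sylProd L) v j = b ^ (L.map Prod.snd).prod ∧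
      ∀ i < j, rho c hc (sylProd L) v i = 1 := by
  induction L with
  | nil => intro j _ h2 h3; simpa [sylProd] using ⟨h2, h3⟩
  | cons p L ih =>
    intro j h1 h2 h3
    obtain ⟨ha, hb⟩ := ih (j + 1) (fun i hi => by
        have := h1 (i + 1) (by simpa using hi)
        rw [show j + 1 + i = j + (i + 1) by omega, this]; simp)
      (by rw [← h2]; congr 1; simp; omega)
      (fun i hi => h3 i (by simp; omega))
    have hs : sylProd (p :: L) = FreeGroup.of p.1 ^ p.2 * sylProd L := by simp [sylProd]
    have hcj : c j = some p.1 := h1 0 (by simp)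
    rw [hs, map_mul]
    simp only [Equiv.Perm.mul_apply, rho_zpow]
    refine ⟨?_, fun i hi => ?_⟩
    · rw [hb j (by omega), ha, hcj]
      simp [← zpow_mul, mul_comm]
    · rw [hb i (by omega), hb (i + 1) (by omega)]; simp

lemma free_res {K : GroupClass.{u}} (hK : IsRootClass K) (S : Type u) :
    KResidual K (FreeGroup S) := by
  intro g hg
  obtain ⟨L, ⟨h0, hch⟩, rfl⟩ := syl_exists g
  have hL : L ≠ [] := by rintro rfl; exact hg (by simp [sylProd])
  have hn : (L.map Prod.snd).prod ≠ 0 := by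
    rw [Ne, List.prod_eq_zero_iff]
    intro h
    obtain ⟨p, hp, hp'⟩ := List.mem_map.1 h
    exact h0 p hp hp'
  obtain ⟨B, _, b, hB, hb⟩ := exists_commB hK _ hn
  let c : ℕ → Option S := fun m => L[m]?.map Prod.fst
  have hc : ∀ m x, c m = some x → c (m + 1) ≠ some x := by
    intro m x h h'
    simp only [c, Option.map_eq_some_iff] at h h'
    obtain ⟨p, hp, rfl⟩ := h
    obtain ⟨q, hq, hq'⟩ := h'
    obtain ⟨i1, rfl⟩ := List.getElem?_eq_some_iff.1 hp
    obtain ⟨i2, rfl⟩ := List.getElem?_eq_some_iff.1 hq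
    exact List.isChain_iff_getElem.1 hch m i2 hq'.symm
  let v : ℕ → B := fun i => if i = L.length then b else 1
  have hlen : 0 < L.length := List.length_pos_iff.2 hL
  obtain ⟨h1, -⟩ := rho_syl c hc b v L 0 (fun i hi => by simp [c, hi]) (by simp [v])
    (fun i hi => by simp [v]; omega)
  obtain ⟨D, hD, hKD, hh⟩ := rho_ker hK hB c hc v L.length
    (fun i hi => by simp [c, hi]) L.length
  refine ⟨D, hD, hKD, fun hm => hb ?_⟩
  rw [← h1, hh _ hm 0 (by omega)]
  simp [v]; omega

end Helpers

section Square

open Monoid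

variable {A : Type u} [Group A] (H : Subgroup A)

abbrev Sq : Type u := PushoutI (fun _ : Bool => H.subtype)

def sqOf (i : Bool) : A →* Sq H := PushoutI.of (φ := fun _ : Bool => H.subtype) i

lemma sqOf_base (i : Bool) (h : H) : sqOf H i h = PushoutI.base (fun _ : Bool => H.subtype) h :=
  PushoutI.of_apply_eq_base (fun _ : Bool => H.subtype) i h

def swapHom : Sq H →* Sq H :=
  PushoutI.lift (fun i => sqOf H (!i)) (PushoutI.base (fun _ : Bool => H.subtype)) (by
    intro i; ext h; exact sqOf_base H _ h)

lemma swapHom_of (i : Bool) (a : A) : swapHom H (sqOf H i a) = sqOf H (!i) a :=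
  PushoutI.lift_of _ _ _ _

lemma sq_ext {G : Type*} [Group G] {f g : Sq H →* G}
    (h : ∀ i a, f (sqOf H i a) = g (sqOf H i a)) : f = g :=
  PushoutI.hom_ext_nonempty (fun i => MonoidHom.ext (h i))

lemma swap_swap : (swapHom H).comp (swapHom H) = MonoidHom.id _ :=
  sq_ext H (fun i a => by simp [swapHom_of])

def sw : MulAut (Sq H) :=
  MonoidHom.toMulEquiv (swapHom H) (swapHom H) (swap_swap H) (swap_swap H)

lemma sw_of (i : Bool) (a : A) : sw H (sqOf H i a) = sqOf H (!i) a := swapHom_of H i a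

def actF : A →* MulAut (FreeGroup (A ⧸ H)) where
  toFun a := FreeGroup.freeGroupCongr (MulAction.toPerm a)
  map_one' := by
    apply MulEquiv.toMonoidHom_injective; ext c; simp
  map_mul' a b := by
    apply MulEquiv.toMonoidHom_injective; ext c; simp [mul_smul]

lemma actF_of (a : A) (c : A ⧸ H) : actF H a (FreeGroup.of c) = FreeGroup.of (a • c) := by
  simp [actF]

abbrev PP : Type u := FreeGroup (A ⧸ H) ⋊[actF H] A
abbrev TT : Type u := Sq H ⋊[MonoidHom.id (MulAut (Sq H))] MulAut (Sq H)

def tt : PP H := SemidirectProduct.inl (FreeGroup.of (QuotientGroup.mk 1))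

lemma tt_comm (h : H) : tt H * SemidirectProduct.inr (h : A) * (tt H)⁻¹ =
    SemidirectProduct.inr (h : A) := by
  have h2 : (SemidirectProduct.inr (h : A) : PP H) * tt H * (SemidirectProduct.inr (h : A))⁻¹
      = tt H := by
    rw [tt, ← map_inv, ← SemidirectProduct.inl_aut, actF_of]
    congr 2
    change (QuotientGroup.mk ((h : A) * 1) : A ⧸ H) = _
    rw [QuotientGroup.eq]; simp
  rw [mul_inv_eq_iff_eq_mul] at h2 ⊢
  exact h2.symm

def Psi : Sq H →* PP H :=
  PushoutI.lift (fun i => if i then (MulAut.conj (tt H)).toMonoidHom.comp SemidirectProduct.inr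
      else SemidirectProduct.inr)
    (SemidirectProduct.inr.comp H.subtype) (by
      intro i
      ext1 h
      cases i
      · rfl
      · exact tt_comm H h)

lemma Psi_false (a : A) : Psi H (sqOf H false a) = SemidirectProduct.inr a :=
  PushoutI.lift_of _ _ _ _

lemma Psi_true (a : A) : Psi H (sqOf H true a) =
    tt H * SemidirectProduct.inr a * (tt H)⁻¹ :=
  PushoutI.lift_of _ _ _ _

def inlT : Sq H →* TT H := SemidirectProduct.inl

def ss : TT H := SemidirectProduct.inr (sw H)

lemma ss_conj (i : Bool) (a : A) :
    ss H * inlT H (sqOf H i a) * (ss H)⁻¹ = inlT H (sqOf H (!i) a) := by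
  rw [ss, ← map_inv, inlT, ← SemidirectProduct.inl_aut, MonoidHom.id_apply, sw_of]

def thetaGen : A ⧸ H → TT H :=
  Quotient.lift (fun a : A => inlT H (sqOf H false a) * ss H * (inlT H (sqOf H false a))⁻¹) (by
    intro a b hab
    obtain ⟨h, rfl⟩ : ∃ h : H, b = a * h :=
      ⟨⟨a⁻¹ * b, QuotientGroup.leftRel_apply.1 hab⟩, by simp⟩
    have h1 := ss_conj H false (h : A)
    have h2 : sqOf H (!false) (h : A) = sqOf H false h := by rw [sqOf_base, sqOf_base]
    rw [h2, mul_inv_eq_iff_eq_mul] at h1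
    simp only [map_mul, mul_inv_rev]
    rw [mul_assoc (inlT H (sqOf H false a)) _ (ss H), ← h1]
    group)

lemma thetaGen_mk (a : A) : thetaGen H (QuotientGroup.mk a) =
    inlT H (sqOf H false a) * ss H * (inlT H (sqOf H false a))⁻¹ := rfl

def Theta : PP H →* TT H :=
  SemidirectProduct.lift (FreeGroup.lift (thetaGen H)) ((inlT H).comp (sqOf H false)) (by
    intro a
    ext1 c
    induction c using QuotientGroup.induction_on with
    | H b =>
      have : a • (QuotientGroup.mk b : A ⧸ H) = QuotientGroup.mk (a * b) := rfl
      simp only [MonoidHom.comp_apply, MulEquiv.coe_toMonoidHom, actF_of,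
        FreeGroup.lift_apply_of, MulAut.conj_apply, this, thetaGen_mk, map_mul, mul_inv_rev]
      group)

lemma Theta_inr (a : A) : Theta H (SemidirectProduct.inr a) = inlT H (sqOf H false a) := by
  simp [Theta]

lemma Theta_tt : Theta H (tt H) = ss H := by
  simp [Theta, tt, thetaGen_mk]

lemma Psi_inj : Function.Injective (Psi H) := by
  have h : (Theta H).comp (Psi H) = inlT H := by
    apply sq_ext
    intro i a
    cases i
    · simp only [MonoidHom.comp_apply, Psi_false, Theta_inr]
    · simp only [MonoidHom.comp_apply, Psi_true, map_mul, map_inv, Theta_inr, Theta_tt]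
      exact ss_conj H false a
  have hi : Function.Injective ((Theta H).comp (Psi H)) := by
    rw [h]; exact SemidirectProduct.inl_injective
  exact Function.Injective.of_comp (f := Theta H) hi

end Square

/-- if `A` belongs to a root class `K` and `H ≤ A`, then the generalized
free square `Q = A *_H A` (the pushout of two copies of the inclusion `H → A`) is
`K`-residual. -/
theorem free_square_kResidual_of_mem (K : GroupClass.{u}) (hK : IsRootClass K)
    (A : Type u) [Group A] (H : Subgroup A) (hA : K A) :
    KResidual K (Monoid.PushoutI (fun _ : Bool => H.subtype)) := by
  intro g hg
  let r : Sq H →* A := SemidirectProduct.rightHom.comp (Psi H)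
  by_cases hr : g ∈ r.ker
  · have hker : ∀ d ∈ r.ker, (Psi H d).right = 1 := fun d hd => hd
    have hl : (Psi H g).left ≠ 1 := by
      intro h
      apply hg
      apply Psi_inj H
      rw [map_one]
      exact SemidirectProduct.ext h (hker g hr)
    obtain ⟨N, hN, hKN, hgN⟩ := free_res hK (A ⧸ H) _ hl
    let f : r.ker →* FreeGroup (A ⧸ H) ⧸ N :=
      { toFun := fun d => QuotientGroup.mk (Psi H d.1).left
        map_one' := by simp
        map_mul' := by
          rintro ⟨a, ha⟩ ⟨b, hb⟩
          rw [← QuotientGroup.mk_mul]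
          congr 1
          change (Psi H (a * b)).left = _
          rw [map_mul, SemidirectProduct.mul_left, hker a ha]; simp }
    obtain ⟨D, hD, hKD, hh⟩ := rc_step hK hKN r.ker inferInstance (rc_ker hK hA r) f
    refine ⟨D, hD, hKD, fun hm => hgN ?_⟩
    obtain ⟨h1, h2⟩ := hh g hm
    exact (QuotientGroup.eq_one_iff _).1 h2
  · exact ⟨r.ker, inferInstance, rc_ker hK hA r, hr⟩
end

section
/- Theorem 4 (full criterion): Let 𝒦 be a root class, A a group, and H a subgroup of A. The generalized free square Q = A *_H A (the amalgamated free product of two copies of A amalgamating H via the identity map, i.e. the pushout of two copies of the inclusion H → A) is 𝒦-residual if and only if A is 𝒦-residual and H is a 𝒦-closed subgroup of A. -/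
open Pointwise

universe u

open scoped Classical in
/-- rewriting of a word along the Cayley graph, deleting the edge `t` -/
noncomputable def trD {S X : Type u} [Group X] (c : X) (t : S × X) :
    X → List (S × Bool) → List ((S × X) × Bool)
  | _, [] => []
  | x, a :: L =>
    if (a.1, cond a.2 x (c * x)) = t then trD c t (cond a.2 (c⁻¹ * x) (c * x)) L
    else ((a.1, cond a.2 x (c * x)), a.2) :: trD c t (cond a.2 (c⁻¹ * x) (c * x)) L

/-- value of a word -/
def wev {S G : Type*} [Group G] (f : S → G) (L : List (S × Bool)) : G :=
  (L.map fun x => cond x.2 (f x.1) (f x.1)⁻¹).prod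

/-- reduced word -/
def wred {S : Type*} (L : List (S × Bool)) : Prop :=
  L.IsChain fun a b => a.1 = b.1 → a.2 = b.2

theorem trD_length {S X : Type u} [Group X] (c : X) (t : S × X) (L : List (S × Bool)) :
    ∀ x, (trD c t x L).length ≤ L.length := by
  induction L with
  | nil => intro x; simp [trD]
  | cons a L ih =>
    intro x
    rw [trD]
    split_ifs
    · exact (ih _).trans (by simp)
    · simpa using ih _

/-- two consecutive edges cannot both be `t` -/
theorem edge_ne {S X : Type u} [Group X] {c : X} (hc : c ≠ 1) {t : S × X} {x : X}
    {a b : S × Bool} (hab : a.1 = b.1 → a.2 = b.2)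
    (ha : (a.1, cond a.2 x (c * x)) = t) :
    (b.1, cond b.2 (cond a.2 (c⁻¹ * x) (c * x)) (c * (cond a.2 (c⁻¹ * x) (c * x)))) ≠ t := by
  rcases a with ⟨a, i⟩
  rcases b with ⟨b, j⟩
  rintro h
  rw [← ha, Prod.mk.injEq] at h
  clear ha
  cases i <;> cases j <;> simp_all

theorem trD_red {S X : Type u} [Group X] {c : X} (hc : c ≠ 1) (t : S × X) (L : List (S × Bool)) :
    ∀ x, wred L → wred (trD c t x L) := by
  induction L with
  | nil => intro x _; simp [trD, wred]
  | cons a L ih =>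
    intro x h
    have hL : wred L := List.IsChain.tail h
    rw [trD]
    split_ifs with hat
    · exact ih _ hL
    · have h1 := ih (cond a.2 (c⁻¹ * x) (c * x)) hL
      rcases L with _ | ⟨b, L⟩
      · simp [trD, wred]
      have hab : a.1 = b.1 → a.2 = b.2 := by
        have := (List.isChain_cons_cons.1 h).1
        exact this
      rw [trD] at h1 ⊢
      split_ifs at h1 ⊢ with hbt
      · rcases L with _ | ⟨d, L⟩
        · simp [trD, wred]
        have hbd : b.1 = d.1 → b.2 = d.2 := by
          have := (List.isChain_cons_cons.1 hL).1
          exact this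
        have hdt := edge_ne hc hbd hbt
        rw [trD, if_neg hdt] at h1 ⊢
        refine List.isChain_cons_cons.2 ⟨?_, h1⟩
        clear h1 ih h hL hbt hdt hat
        rcases a with ⟨a, i⟩
        rcases b with ⟨b, j⟩
        rcases d with ⟨d, k⟩
        cases i <;> cases j <;> cases k <;> simp_all
      · refine List.isChain_cons_cons.2 ⟨?_, h1⟩
        intro h
        exact hab (congrArg (fun z => z.1) h)

open scoped Classical in
theorem wev_wreath {S X G : Type u} [Group X] [Group G] (c : X) (t : S × X) (f : S × X → G)
    (L : List (S × Bool)) : ∀ x,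
    (wev (fun s => (⟨fun x => if (s, x) = t then 1 else f (s, x), c⟩ : G ≀ᵣ X)) L).left x
      = wev f (trD c t x L) := by
  induction L with
  | nil => intro x; simp [wev, trD]
  | cons a L ih =>
    intro x
    rcases a with ⟨a, i⟩
    have key : ∀ (p : G ≀ᵣ X) (M : List (S × Bool)) (F : S → G ≀ᵣ X), 
      (wev F ((a, i) :: M)) = cond i (F a) (F a)⁻¹ * wev F M := by
      intro p M F; simp [wev]
    rw [key 1]
    cases i
    · simp only [cond_false, RegularWreathProduct.mul_left, Pi.mul_apply,
        RegularWreathProduct.inv_left, RegularWreathProduct.inv_right, inv_inv, ih, trD,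
        Pi.inv_apply]
      split_ifs <;> simp [wev]
    · simp only [cond_true, RegularWreathProduct.mul_left, Pi.mul_apply, ih, trD]
      split_ifs <;> simp [wev]

section
variable {K : GroupClass.{u}}

theorem root_emb (hK : IsRootClass K) {G P : Type u} [Group G] [Group P] (f : G →* P) (hP : K P) :
    K (G ⧸ f.ker) :=
  hK.1 _ _ (QuotientGroup.quotientKerEquivRange f).symm (hK.2.2.1 _ hP _)

theorem root_inj (hK : IsRootClass K) {G P : Type u} [Group G] [Group P] (f : G →* P)
    (hf : Function.Injective f) (hP : K P) : K G :=
  hK.1 _ _ (MonoidHom.ofInjective hf).symm (hK.2.2.1 _ hP _)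

theorem root_wreath_s13 (hK : IsRootClass K) {G X : Type u} [Group G] [Group X] (hG : K G) (hX : K X) :
    K (G ≀ᵣ X) := by
  let π : G ≀ᵣ X →* X := RegularWreathProduct.rightHom
  let ev : π.ker →* G :=
    { toFun := fun w => w.1.left 1
      map_one' := rfl
      map_mul' := by
        rintro ⟨a, ha⟩ ⟨b, hb⟩
        have ha' : a.right = 1 := ha
        simp [ha'] }
  obtain ⟨D, hD, hle, hKD⟩ := hK.2.2.2.2 (G ≀ᵣ X) π.ker ev.ker (root_emb hK π hX)
    (root_emb hK ev hG)
  have hbot : ∀ d ∈ D, d = 1 := by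
    intro d hd
    have h1 : ∀ d ∈ D, d.right = 1 ∧ d.left 1 = 1 := by
      intro d hd
      obtain ⟨⟨e, he⟩, h, rfl⟩ := hle hd
      exact ⟨he, h⟩
    have hr := (h1 d hd).1
    ext x
    · have := (h1 _ (hD.conj_mem d hd (RegularWreathProduct.inl x⁻¹))).2
      simpa [hr] using this
    · exact hr
  have : D = ⊥ := (Subgroup.eq_bot_iff_forall D).2 hbot
  refine root_inj hK (QuotientGroup.mk' D) ?_ hKD
  rw [← MonoidHom.ker_eq_bot_iff, QuotientGroup.ker_mk', this]

theorem root_free (hK : IsRootClass K) (n : ℕ) : ∀ (S : Type u) (L : List (S × Bool)),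
    L.length ≤ n → wred L → L ≠ [] →
    ∃ (G : Type u) (_ : Group G) (_ : K G) (f : S → G), wev f L ≠ 1 := by
  classical
  induction n with
  | zero => intro S L h _ h'; exact absurd (by simpa using h) h'
  | succ n ih =>
    intro S L hlen hred hne
    obtain ⟨X, _, hnt, hX⟩ := hK.2.1
    obtain ⟨c, hc⟩ := exists_ne (1 : X)
    rcases L with _ | ⟨a, L⟩
    · exact absurd rfl hne
    rcases L with _ | ⟨b, L⟩
    · refine ⟨X, _, hX, fun _ => c, ?_⟩
      rcases a with ⟨a, i⟩
      cases i <;> simpa [wev] using hc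
    let t : S × X := (a.1, cond a.2 1 (c * 1))
    have hab : a.1 = b.1 → a.2 = b.2 := by
      have := (List.isChain_cons_cons.1 hred).1
      exact this
    have hbt := edge_ne (x := 1) hc (t := t) hab rfl
    have hred' := trD_red hc t _ 1 hred
    have hD : trD c t 1 (a :: b :: L) = trD c t (cond a.2 (c⁻¹ * 1) (c * 1)) (b :: L) := by
      rw [trD, if_pos rfl]
    obtain ⟨G, _, hG, f, hf⟩ := ih (S × X) (trD c t 1 (a :: b :: L))
      (by
        rw [hD]
        have := trD_length c t (b :: L) (cond a.2 (c⁻¹ * 1) (c * 1))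
        simp only [List.length_cons] at this hlen
        omega) hred'
      (by rw [hD, trD, if_neg hbt]; simp)
    refine ⟨G ≀ᵣ X, _, root_wreath_s13 hK hG hX,
      fun s => ⟨fun x => if (s, x) = t then 1 else f (s, x), c⟩, ?_⟩
    intro h
    apply hf
    rw [← wev_wreath, h]
    rfl

theorem closed_hom (hK : IsRootClass K) {A : Type u} [Group A] {H : Subgroup A}
    (hH : KClosed K H) (L : List (Bool × A)) : (∀ a ∈ L, a.2 ∉ H) →
    ∃ (B : Type u) (_ : Group B) (_ : K B) (π : A →* B), ∀ a ∈ L, π a.2 ∉ H.map π := by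
  induction L with
  | nil =>
    intro _
    obtain ⟨X, _, hnt, hX⟩ := hK.2.1
    exact ⟨X, _, hX, 1, by simp⟩
  | cons a L ih =>
    intro h
    obtain ⟨B, _, hB, π, hπ⟩ := ih fun b hb => h b (by simp [hb])
    obtain ⟨N, hN, hKN, haN⟩ := hH a.2 (h a (by simp))
    refine ⟨B × (A ⧸ N), _, hK.2.2.2.1 _ _ hB hKN, π.prod (QuotientGroup.mk' N), ?_⟩
    intro b hb
    rcases List.mem_cons.1 hb with rfl | hb
    · rintro ⟨k, hk, e⟩
      apply haN
      have e2 : (k : A ⧸ N) = (b.2 : A ⧸ N) := congrArg Prod.snd e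
      refine Set.mem_mul.2 ⟨b.2 * k⁻¹, ?_, k, hk, by simp⟩
      have := hN.mem_comm (QuotientGroup.eq.1 e2)
      exact this
    · rintro ⟨k, hk, e⟩
      exact hπ b hb ⟨k, hk, congrArg Prod.fst e⟩

/-- free group word attached to an amalgam word -/
def amW {B : Type u} [Group B] (H : Subgroup B) : B → List (Bool × B) → List ((B ⧸ H) × Bool)
  | _, [] => []
  | x, a :: L => cond a.1
    ((((x⁻¹ : B) : B ⧸ H), true) :: (((x⁻¹ * a.2 : B) : B ⧸ H), false) :: amW H (a.2⁻¹ * x) L)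
    (amW H (a.2⁻¹ * x) L)

theorem amW_red {B : Type u} [Group B] (H : Subgroup B) (L : List (Bool × B)) :
    ∀ x, (∀ a ∈ L, a.2 ∉ H) → L.IsChain (fun a b => a.1 ≠ b.1) → wred (amW H x L) ∧
      (∀ b ∈ L.head?, b.1 = false → ∀ e ∈ (amW H x L).head?, e.1 ≠ ((x⁻¹ : B) : B ⧸ H)) := by
  induction L with
  | nil => intro x _ _; simp [amW, wred]
  | cons a L ih =>
    intro x h hc
    have hL := ih (a.2⁻¹ * x) (fun b hb => h b (by simp [hb])) hc.tail
    have hne : ((x⁻¹ : B) : B ⧸ H) ≠ ((x⁻¹ * a.2 : B) : B ⧸ H) := by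
      rw [Ne, QuotientGroup.eq]
      simpa using h a (by simp)
    rcases a with ⟨i, a⟩
    cases i
    · simp only [amW, cond_false]
      refine ⟨hL.1, ?_⟩
      intro b hb _ e he
      rcases L with _ | ⟨⟨j, b⟩, L⟩
      · simp [amW] at he
      cases j
      · simp at hc
      simp only [amW, cond_true, List.head?_cons, Option.mem_def, Option.some.injEq] at he
      subst he
      simpa using hne.symm
    · simp only [amW, cond_true]
      refine ⟨?_, by simp⟩
      refine List.isChain_cons_cons.2 ⟨fun h => absurd h hne, ?_⟩
      rcases L with _ | ⟨⟨j, b⟩, L⟩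
      · simp [amW]
      cases j
      · refine List.isChain_cons.2 ⟨?_, hL.1⟩
        intro e he h
        have := hL.2 (false, b) (by simp) rfl e he
        simp at this
        exact absurd h.symm this
      · simp at hc

/-- the twisting element -/
def twY {B G : Type u} [Group B] [Group G] (H : Subgroup B) (θ : B ⧸ H → G) : G ≀ᵣ B :=
  ⟨fun x => θ ((x⁻¹ : B) : B ⧸ H), 1⟩

/-- the two embeddings -/
def twHom {B G : Type u} [Group B] [Group G] (H : Subgroup B) (θ : B ⧸ H → G) (i : Bool) :
    B →* G ≀ᵣ B :=
  cond i ((MulAut.conj (twY H θ)).toMonoidHom.comp RegularWreathProduct.inl)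
    RegularWreathProduct.inl

theorem twHom_agree {B G : Type u} [Group B] [Group G] (H : Subgroup B) (θ : B ⧸ H → G) (i : Bool)
    (h : B) (hh : h ∈ H) : twHom H θ i h = RegularWreathProduct.inl h := by
  cases i
  · rfl
  · have : ∀ x : B, ((x⁻¹ * h : B) : B ⧸ H) = ((x⁻¹ : B) : B ⧸ H) := by
      intro x; rw [QuotientGroup.eq]; simpa using hh
    ext x
    · simp [twHom, twY, this]
    · simp [twHom, twY]

theorem tw_left {B G : Type u} [Group B] [Group G] (H : Subgroup B) (θ : B ⧸ H → G)
    (L : List (Bool × B)) : ∀ x,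
    ((L.map fun a => twHom H θ a.1 a.2).prod).left x = wev θ (amW H x L) := by
  induction L with
  | nil => intro x; simp [wev, amW]
  | cons a L ih =>
    intro x
    rcases a with ⟨i, a⟩
    rw [List.map_cons, List.prod_cons, RegularWreathProduct.mul_left, Pi.mul_apply, ih]
    cases i
    · simp [twHom, amW]
    · simp [twHom, twY, amW, wev, mul_assoc]

theorem am_exists {A : Type u} [Group A] (H : Subgroup A)
    (g : Monoid.PushoutI (fun _ : Bool => H.subtype)) :
    ∃ (h : H) (L : List (Bool × A)), (∀ a ∈ L, a.2 ∉ H) ∧ L.IsChain (fun a b => a.1 ≠ b.1) ∧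
      g = Monoid.PushoutI.base _ h *
        (L.map fun a => Monoid.PushoutI.of (φ := fun _ : Bool => H.subtype) a.1 a.2).prod := by
  classical
  obtain ⟨d⟩ := Monoid.PushoutI.NormalWord.transversal_nonempty (fun _ : Bool => H.subtype)
    (fun _ => H.subtype_injective)
  let w := Monoid.PushoutI.NormalWord.equiv (d := d) g
  have hw : w.prod = g := Monoid.PushoutI.NormalWord.equiv.symm_apply_apply g
  refine ⟨w.head, w.toList.map fun a => (a.1, a.2), ?_, ?_, ?_⟩
  · intro a ha hH
    obtain ⟨⟨i, b⟩, hb, rfl⟩ := List.mem_map.1 ha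
    have h1 := w.normalized i b hb
    have hb1 : b ≠ 1 := by
      rintro rfl
      exact w.ne_one _ hb rfl
    have := (d.compl i).1 (a₁ := (⟨b, by simpa using hH⟩, ⟨1, d.one_mem i⟩))
      (a₂ := (⟨1, one_mem _⟩, ⟨b, h1⟩)) (by simp)
    apply hb1
    simpa using congrArg (fun z => (z.1 : A)) this
  · rw [List.isChain_map]
    exact w.chain_ne
  · rw [← hw, Monoid.PushoutI.NormalWord.prod, Monoid.CoprodI.Word.prod, map_list_prod]
    simp [Function.comp_def]

theorem residual_of_hom (hK : IsRootClass K) {G P : Type u} [Group G] [Group P] (f : G →* P)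
    (hP : K P) (g : G) (hg : f g ≠ 1) : ∃ (N : Subgroup G) (hN : N.Normal),
    (letI := hN; K (G ⧸ N)) ∧ g ∉ N :=
  ⟨f.ker, inferInstance, root_emb hK f hP, hg⟩

end

/-- Theorem 4: the generalized free square `Q = A *_H A` (the pushout of
two copies of the inclusion `H → A`) is `K`-residual if and only if `A` is `K`-residual
and `H` is a `K`-closed subgroup of `A`, for a root class `K`. -/
theorem free_square_kResidual_iff (K : GroupClass.{u}) (hK : IsRootClass K)
    (A : Type u) [Group A] (H : Subgroup A) :
    KResidual K (Monoid.PushoutI (fun _ : Bool => H.subtype)) ↔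
      KResidual K A ∧ KClosed K H := by
  have hinj : ∀ i : Bool, Function.Injective
      (Monoid.PushoutI.of (φ := fun _ : Bool => H.subtype) i) :=
    Monoid.PushoutI.of_injective (fun _ => H.subtype_injective)
  constructor
  · intro hQ
    constructor
    · intro a ha
      obtain ⟨N, hN, hKN, haN⟩ := hQ (Monoid.PushoutI.of true a) (by
        intro h; exact ha (hinj true (by rw [h, map_one])))
      refine residual_of_hom hK ((QuotientGroup.mk' N).comp (Monoid.PushoutI.of true)) hKN a ?_
      simpa using haN
    · intro a ha
      obtain ⟨N, hN, hKN, haN⟩ := hQ ((Monoid.PushoutI.of true a)⁻¹ * (Monoid.PushoutI.of false a)) (by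
        intro h
        have h := inv_mul_eq_one.1 h
        have : Monoid.PushoutI.of (φ := fun _ : Bool => H.subtype) true a ∈
            (Monoid.PushoutI.base (fun _ : Bool => H.subtype)).range := by
          rw [← Monoid.PushoutI.inf_of_range_eq_base_range (fun _ => H.subtype_injective)
            (show true ≠ false by simp)]
          exact ⟨⟨a, rfl⟩, ⟨a, h.symm⟩⟩
        obtain ⟨k, hk⟩ := this
        rw [← Monoid.PushoutI.of_apply_eq_base _ true] at hk
        have := hinj true hk
        exact ha (this ▸ k.2))
      let f : Bool → (A →* _ ⧸ N) := fun i => (QuotientGroup.mk' N).comp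
        (Monoid.PushoutI.of (φ := fun _ : Bool => H.subtype) i)
      have hf : ∀ k ∈ H, f true k = f false k := by
        intro k hk
        have := fun i => Monoid.PushoutI.of_apply_eq_base (fun _ : Bool => H.subtype) i ⟨k, hk⟩
        exact congrArg (QuotientGroup.mk' N) ((this true).trans (this false).symm)
      refine ⟨((f true).prod (f false)).ker, inferInstance,
        root_emb hK _ (hK.2.2.2.1 _ _ hKN hKN), ?_⟩
      intro hmem
      obtain ⟨n, hn, k, hk, rfl⟩ := Set.mem_mul.1 hmem
      have h1 : f true n = 1 := congrArg Prod.fst hn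
      have h2 : f false n = 1 := congrArg Prod.snd hn
      apply haN
      rw [← QuotientGroup.eq]
      change f true (n * k) = f false (n * k)
      rw [map_mul, map_mul, h1, h2, hf k hk]
  · rintro ⟨hA, hH⟩ g hg
    obtain ⟨h, L, hLH, hLc, rfl⟩ := am_exists H g
    by_cases hL : L = []
    · subst hL
      have hh : (h : A) ≠ 1 := by
        rintro e
        apply hg
        have : h = 1 := Subtype.ext e
        simp [this]
      obtain ⟨N, hN, hKN, haN⟩ := hA h hh
      refine residual_of_hom hK ((QuotientGroup.mk' N).comp
        (Monoid.PushoutI.lift (fun _ => MonoidHom.id A) H.subtype (fun _ => rfl))) hKN _ ?_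
      simpa using haN
    · obtain ⟨B, _, hB, π, hπ⟩ := closed_hom hK hH L hLH
      let M : List (Bool × B) := L.map fun a => (a.1, π a.2)
      have hM : ∀ a ∈ M, a.2 ∉ H.map π := by
        intro a ha
        obtain ⟨b, hb, rfl⟩ := List.mem_map.1 ha
        exact hπ b hb
      have hMc : M.IsChain (fun a b => a.1 ≠ b.1) := by
        rw [List.isChain_map]
        exact hLc
      have hMne : M ≠ [] := by simpa [M] using hL
      -- a suitable homomorphism
      have main : ∃ (G : Type u) (_ : Group G) (_ : K G) (θ : B ⧸ H.map π → G),
          (RegularWreathProduct.inl (π h) *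
            (M.map fun a => twHom (H.map π) θ a.1 a.2).prod) ≠ 1 := by
        by_cases hW : amW (H.map π) 1 M = []
        · refine ⟨B, _, hB, fun _ => 1, ?_⟩
          rcases hMM : M with _ | ⟨⟨i, b⟩, M'⟩
          · exact absurd hMM hMne
          rw [hMM] at hW hMc hM
          cases i
          · rcases M' with _ | ⟨⟨j, b'⟩, M'⟩
            · intro e
              have e' := congrArg RegularWreathProduct.right e
              simp [twHom] at e'
              apply hM (false, b) (by simp)
              have : b = (π h)⁻¹ := (inv_eq_of_mul_eq_one_right e').symm
              simp only [this]
              exact inv_mem ⟨h, h.2, rfl⟩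
            · cases j
              · simp at hMc
              · simp [amW] at hW
          · simp [amW] at hW
        · obtain ⟨G, _, hG, θ, hθ⟩ := root_free hK _ _ _ le_rfl
            (amW_red (H.map π) M 1 hM hMc).1 hW
          refine ⟨G, _, hG, θ, ?_⟩
          intro e
          apply hθ
          have e' := congrFun (congrArg RegularWreathProduct.left e) (π h)
          rw [RegularWreathProduct.mul_left, Pi.mul_apply] at e'
          simpa [tw_left] using e'
      obtain ⟨G, _, hG, θ, hθ⟩ := main
      refine residual_of_hom hK (Monoid.PushoutI.lift
        (fun i => (twHom (H.map π) θ i).comp π)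
        ((RegularWreathProduct.inl.comp π).comp H.subtype) ?_) (root_wreath_s13 hK hG hB) _ ?_
      · intro i
        ext1 k
        exact twHom_agree _ _ _ _ ⟨k, k.2, rfl⟩
      · rw [map_mul, map_list_prod]
        simpa [M, Function.comp_def] using hθ
end

section
/- Theorem 5: Let 𝒦 be a root class, let (G_λ)_{λ ∈ Λ} be a (possibly infinite) family of groups, let H be a group, and for each λ ∈ Λ let i_λ : H → G_λ be an injective homomorphism. Let G be the generalized free product of the family (G_λ)_{λ ∈ Λ} amalgamating the common subgroup H (the pushout of the family of maps (i_λ)_{λ ∈ Λ} in the category of groups, identifying all copies of H). If every G_λ is 𝒦-residual and there exists a group G' in 𝒦 and a homomorphism φ : G → G' whose restriction to the (canonical image of the) subgroup H is injective, then G is 𝒦-residual. -/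
open Pointwise

universe u

/-- An element detected by a homomorphism to a group in the class. -/
def GfpDet (K : GroupClass.{u}) {G : Type u} [Group G] (g : G) : Prop :=
  ∃ (B : Type u) (_ : Group B) (ψ : G →* B), K B ∧ ψ g ≠ 1

theorem gfp_quot_ker {K : GroupClass.{u}} (hK : IsRootClass K) {G B : Type u} [Group G] [Group B]
    (hB : K B) (ψ : G →* B) : K (G ⧸ ψ.ker) :=
  hK.1 _ _ (QuotientGroup.quotientKerEquivRange ψ).symm (hK.2.2.1 B hB ψ.range)

theorem gfp_det_of_ker {K : GroupClass.{u}} (hK : IsRootClass K) {G A B : Type u}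
    [Group G] [Group A] [Group B] (hA : K A) (hB : K B) (ψ : G →* B)
    (ρ : ψ.ker →* A) (g : G) (hg : g ∈ ψ.ker) (h1 : ρ ⟨g, hg⟩ ≠ 1) : GfpDet K g := by
  obtain ⟨D, hD, hle, hKD⟩ := hK.2.2.2.2 G ψ.ker ρ.ker (gfp_quot_ker hK hB ψ)
    (gfp_quot_ker hK hA ρ)
  refine ⟨G ⧸ D, inferInstance, QuotientGroup.mk' D, hKD, ?_⟩
  intro h
  have : g ∈ D := by simpa using h
  obtain ⟨y, hy, hyg⟩ := hle this
  apply h1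
  have : y = ⟨g, hg⟩ := Subtype.ext hyg
  rw [← this]; exact hy

theorem gfp_det_wreath {K : GroupClass.{u}} (hK : IsRootClass K) {G A B : Type u}
    [Group G] [Group A] [Group B] (hA : K A) (hB : K B)
    (Θ : G →* RegularWreathProduct A B) (g : G) (hg : (Θ g).right = 1)
    (h1 : (Θ g).left 1 ≠ 1) : GfpDet K g := by
  let ψ : G →* B := RegularWreathProduct.rightHom.comp Θ
  let ρ : ψ.ker →* A :=
    { toFun := fun m => (Θ m).left 1
      map_one' := by simp
      map_mul' := by
        rintro ⟨a, ha⟩ ⟨b, hb⟩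
        have ha' : (Θ a).right = 1 := ha
        simp [ha'] }
  exact gfp_det_of_ker hK hA hB ψ ρ g hg h1

section
variable {Λ : Type u} {Gf : Λ → Type u} [∀ l, Group (Gf l)] {H : Type u} [Group H]
    {φ : ∀ l, H →* Gf l}
open Monoid PushoutI

theorem gfp_theta {A B : Type u} [Group A] [Group B] (ψ : PushoutI φ →* B)
    (τ : ∀ l, Gf l →* A) (t : Λ → B → A)
    (ht : ∀ l h x, t l (ψ (base φ h) * x) = τ l (φ l h) * t l x) :
    ∃ Θ : PushoutI φ →* RegularWreathProduct A B, (∀ g, (Θ g).right = ψ g) ∧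
      ∀ l (g : Gf l) x,
        (Θ (of l g)).left x = (t l x)⁻¹ * τ l g * t l ((ψ (of l g))⁻¹ * x) := by
  let f : ∀ l, Gf l →* RegularWreathProduct A B := fun l =>
    { toFun := fun g => ⟨fun x => (t l x)⁻¹ * τ l g * t l ((ψ (of l g))⁻¹ * x), ψ (of l g)⟩
      map_one' := by ext <;> simp
      map_mul' := by intro a b; ext <;> simp [mul_assoc] }
  let k : H →* RegularWreathProduct A B := RegularWreathProduct.inl.comp (ψ.comp (base φ))
  have hf : ∀ l, (f l).comp (φ l) = k := by
    intro l
    ext h x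
    · have := ht l h⁻¹ x
      simp only [map_inv] at this
      simp [f, k, of_apply_eq_base, this, mul_assoc]
    · simp [f, k, of_apply_eq_base]
  refine ⟨lift f k hf, ?_, ?_⟩
  · have : RegularWreathProduct.rightHom.comp (lift f k hf) = ψ := by
      apply hom_ext
      · intro l; ext g; simp [f]
      · ext h; simp [k]
    intro g
    exact DFunLike.congr_fun this g
  · intro l g x
    simp [f]

/-- product of a list of letters -/
def gfpW (φ : ∀ l, H →* Gf l) (L : List (Σ l, Gf l)) : PushoutI φ :=
  (L.map fun s => of s.1 s.2).prod

theorem gfp_exists_word [Nonempty Λ] (g : PushoutI φ) : ∃ L, gfpW φ L = g := by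
  induction g using PushoutI.induction_on with
  | of l g => exact ⟨[⟨l, g⟩], by simp [gfpW]⟩
  | base h =>
    let l := Classical.arbitrary Λ
    exact ⟨[⟨l, φ l h⟩], by simp [gfpW, of_apply_eq_base]⟩
  | mul x y hx hy =>
    obtain ⟨L, rfl⟩ := hx
    obtain ⟨M, rfl⟩ := hy
    exact ⟨L ++ M, by simp [gfpW]⟩

/-- The length one case. -/
theorem gfp_det_of {K : GroupClass.{u}} (hK : IsRootClass K)
    (hG : ∀ l, KResidual K (Gf l)) {B : Type u} [Group B] (hB : K B) (ψ : PushoutI φ →* B)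
    (hψ : ∀ h h', ψ (base φ h) = ψ (base φ h') → h = h') (l : Λ) (g : Gf l)
    (hg : (of l g : PushoutI φ) ≠ 1) : GfpDet K (of l g : PushoutI φ) := by
  classical
  by_cases h1 : ψ (of l g) = 1
  swap
  · exact ⟨B, _, ψ, hB, h1⟩
  have hg1 : g ≠ 1 := by rintro rfl; simp at hg
  obtain ⟨N, hN, hKN, hgN⟩ := hG l g hg1
  let R : Subgroup B := (ψ.comp (base φ)).range
  let rep : B → B := fun x => (Quotient.mk (QuotientGroup.rightRel R) x).out
  have hrep : ∀ x, ∃ h, ψ (base φ h) * rep x = x := by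
    intro x
    have : (QuotientGroup.rightRel R) (rep x) x := Quotient.exact (Quotient.out_eq _)
    rw [QuotientGroup.rightRel_apply] at this
    obtain ⟨h, hh⟩ := this
    exact ⟨h, by simpa using congrArg (· * rep x) hh⟩
  have hrep2 : ∀ h x, rep (ψ (base φ h) * x) = rep x := by
    intro h x
    have : Quotient.mk (QuotientGroup.rightRel R) (ψ (base φ h) * x) = Quotient.mk _ x := by
      apply Quotient.sound
      change (QuotientGroup.rightRel R) _ _
      rw [QuotientGroup.rightRel_apply]
      exact ⟨h⁻¹, by simp⟩
    simp only [rep, this]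
  choose s hs using hrep
  have hs2 : ∀ h x, s (ψ (base φ h) * x) = h * s x := by
    intro h x
    apply hψ
    have h1 := hs (ψ (base φ h) * x)
    rw [hrep2] at h1
    apply mul_right_cancel (b := rep x)
    rw [h1, map_mul, map_mul, mul_assoc, hs]
  let A := Gf l ⧸ N
  let q : Gf l →* A := QuotientGroup.mk' N
  let τ : ∀ m, Gf m →* A := Function.update (fun m => (1 : Gf m →* A)) l q
  let t : Λ → B → A := Function.update (fun _ _ => 1) l (fun x => q (φ l (s x)))
  obtain ⟨Θ, hΘ1, hΘ2⟩ := gfp_theta ψ τ t (by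
    intro m h x
    by_cases hm : m = l
    · subst hm; simp [τ, t, hs2]
    · simp [τ, t, hm])
  refine gfp_det_wreath hK hKN hB Θ _ (by rw [hΘ1, h1]) ?_
  rw [hΘ2, h1]
  intro h
  apply hgN
  have : q g = 1 := by
    simp only [τ, t, Function.update_self, inv_one, one_mul] at h
    rwa [mul_assoc, inv_mul_eq_one, right_eq_mul] at h
  exact (QuotientGroup.eq_one_iff g).1 this

theorem gfp_sep {K : GroupClass.{u}} (hK : IsRootClass K)
    {B : Type u} [Group B] (hB : K B) (ψ : PushoutI φ →* B)
    (hψ : ∀ h h', ψ (base φ h) = ψ (base φ h') → h = h')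
    (l : List (PushoutI φ))
    (hl : ∀ p ∈ l, ∀ h, GfpDet K (base φ h * p)) :
    ∃ (B : Type u) (_ : Group B) (ψ : PushoutI φ →* B), K B ∧
      (∀ h h', ψ (base φ h) = ψ (base φ h') → h = h') ∧
      ∀ p ∈ l, ∀ h, ψ p ≠ ψ (base φ h) := by
  induction l with
  | nil => exact ⟨B, _, ψ, hB, hψ, by simp⟩
  | cons p l ih =>
    obtain ⟨B, _, ψ, hB, hψ, hp⟩ := ih (fun p hp => hl p (by simp [hp]))
    by_cases hc : ∃ h, ψ p = ψ (base φ h)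
    · obtain ⟨h0, hh0⟩ := hc
      obtain ⟨C, _, χ, hC, hχ⟩ := hl p (by simp) h0⁻¹
      refine ⟨B × C, inferInstance, ψ.prod χ, hK.2.2.2.1 _ _ hB hC, ?_, ?_⟩
      · intro h h' e
        exact hψ _ _ (congrArg Prod.fst e)
      · intro p' hp' h e
        have e1 : ψ p' = ψ (base φ h) := congrArg Prod.fst e
        have e2 : χ p' = χ (base φ h) := congrArg Prod.snd e
        rcases List.mem_cons.1 hp' with rfl | hp'
        · have : h0 = h := hψ _ _ (hh0.symm.trans e1)
          subst this
          apply hχ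
          simp [e2]
        · exact hp p' hp' h e1
    · push Not at hc
      refine ⟨B, _, ψ, hB, hψ, ?_⟩
      intro p' hp'
      rcases List.mem_cons.1 hp' with rfl | hp'
      · exact hc
      · exact hp p' hp'

theorem gfp_mid {A B : Type u} [Group A] [Group B] (ψ : PushoutI φ →* B)
    (t : Λ → B → A) (Θ : PushoutI φ →* RegularWreathProduct A B) (hΘ1 : ∀ g, (Θ g).right = ψ g)
    (hΘ2 : ∀ l (g : Gf l) x, (Θ (of l g)).left x = (t l x)⁻¹ * t l ((ψ (of l g))⁻¹ * x))
    (m : List (Σ l, Gf l)) (a : PushoutI φ)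
    (hm : ∀ p, p <+: m → ∀ l, t l (ψ (a * gfpW φ p))⁻¹ = 1) :
    (Θ (gfpW φ m)).left (ψ a)⁻¹ = 1 := by
  induction m generalizing a with
  | nil => simp [gfpW]
  | cons s m ih =>
    have e : gfpW φ (s :: m) = of s.1 s.2 * gfpW φ m := by simp [gfpW]
    have h0 := hm [] (by simp) s.1
    have h1 := hm [s] (by simp) s.1
    have h2 := ih (a * of s.1 s.2) (by
      intro p hp l
      have := hm (s :: p) (by simpa using hp) l
      simpa [gfpW, mul_assoc] using this)
    simp only [gfpW, List.map_nil, List.prod_nil, mul_one, List.map_cons, List.prod_cons] at h0 h1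
    rw [e, map_mul, RegularWreathProduct.mul_left, Pi.mul_apply, hΘ2, hΘ1, ← mul_inv_rev,
      ← map_mul, h0, h1, h2]
    simp

theorem gfp_absorb (h : H) (s : Σ l, Gf l) (L : List (Σ l, Gf l)) :
    base φ h * gfpW φ (s :: L) = gfpW φ (⟨s.1, φ s.1 h * s.2⟩ :: L) := by
  simp [gfpW, mul_assoc, of_apply_eq_base]

theorem gfp_conj {K : GroupClass.{u}} {G : Type u} [Group G] (a b : G) (h : GfpDet K (b * a)) :
    GfpDet K (a * b) := by
  obtain ⟨B, _, ψ, hB, h⟩ := h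
  refine ⟨B, _, ψ, hB, fun h' => h ?_⟩
  rw [map_mul] at h' ⊢
  exact mul_eq_one_comm.1 h'

theorem gfp_main {K : GroupClass.{u}} (hK : IsRootClass K)
    (hG : ∀ l, KResidual K (Gf l)) {B : Type u} [Group B] (hB : K B) (ψ : PushoutI φ →* B)
    (hψ : ∀ h h', ψ (base φ h) = ψ (base φ h') → h = h') (n : ℕ) :
    ∀ L : List (Σ l, Gf l), L.length = n → gfpW φ L ≠ 1 → GfpDet K (gfpW φ L) := by
  classical
  induction n using Nat.strong_induction_on with
  | _ n ih =>
  intro L hL hne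
  have ih' : ∀ L' : List (Σ l, Gf l), L'.length < L.length → gfpW φ L' ≠ 1 →
      GfpDet K (gfpW φ L') := fun L' h => ih _ (hL ▸ h) L' rfl
  clear ih
  rcases L with _ | ⟨s, L⟩
  · simp [gfpW] at hne
  rcases List.eq_nil_or_concat L with rfl | ⟨m, b, rfl⟩
  · have e : gfpW φ [s] = of s.1 s.2 := by simp [gfpW]
    rw [e] at hne ⊢
    exact gfp_det_of hK hG hB ψ hψ _ _ hne
  simp only [List.concat_eq_append] at *
  have e : gfpW φ (s :: (m ++ [b])) = of s.1 s.2 * gfpW φ m * of b.1 b.2 := by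
    simp [gfpW, mul_assoc]
  by_cases hsb : b.1 = s.1
  · obtain ⟨i, x⟩ := s
    obtain ⟨j, y⟩ := b
    obtain rfl : j = i := hsb
    have e2 : gfpW φ (⟨j, y * x⟩ :: m) = of j y * (of j x * gfpW φ m) := by
      simp [gfpW, mul_assoc]
    rw [e] at hne ⊢
    apply gfp_conj
    rw [← e2]
    apply ih'
    · simp
    · rw [e2]
      intro h
      exact hne (mul_eq_one_comm.1 h)
  by_contra hnd
  have hpre : ∀ p, p <+: m → ∀ h, base φ h * gfpW φ (s :: p) ≠ 1 := by
    rintro p ⟨q, rfl⟩ h hh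
    have e1 : gfpW φ (s :: p) = base φ h⁻¹ := by
      rw [map_inv]; exact eq_inv_of_mul_eq_one_right hh
    have e2 : gfpW φ (s :: (p ++ q ++ [b])) = base φ h⁻¹ * gfpW φ (q ++ [b]) := by
      rw [← e1]; simp [gfpW, mul_assoc]
    obtain ⟨c, r, hcr⟩ : ∃ c r, q ++ [b] = c :: r := by
      cases q with
      | nil => exact ⟨b, [], rfl⟩
      | cons c q => exact ⟨c, q ++ [b], rfl⟩
    have hlen := congrArg List.length hcr
    rw [hcr, gfp_absorb] at e2
    apply hnd
    rw [e2] at hne ⊢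
    apply ih' _ _ hne
    simp at hlen ⊢
    omega
  obtain ⟨B, _, ψ, hB, hψ, hsep⟩ := gfp_sep hK hB ψ hψ (m.inits.map fun p => gfpW φ (s :: p)) (by
    intro x hx h
    obtain ⟨p, hp, rfl⟩ := List.mem_map.1 hx
    have hp := List.mem_inits p m |>.1 hp
    have := hpre p hp h
    rw [gfp_absorb] at this ⊢
    apply ih' _ _ this
    have := hp.length_le
    simp
    omega)
  have hsep' : ∀ p, p <+: m → ∀ h, ψ (of s.1 s.2 * gfpW φ p) ≠ ψ (base φ h) := by
    intro p hp h
    have := hsep (gfpW φ (s :: p)) (List.mem_map.2 ⟨p, (List.mem_inits p m).2 hp, rfl⟩) h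
    simpa [gfpW] using this
  by_cases h1 : ψ (gfpW φ (s :: (m ++ [b]))) = 1
  swap
  · exact hnd ⟨B, _, ψ, hB, h1⟩
  obtain ⟨A, _, ⟨c, d, hcd⟩, hA⟩ := hK.2.1
  obtain ⟨c, hc⟩ : ∃ c : A, c ≠ 1 := by
    by_cases h : c = 1
    · exact ⟨d, fun h' => hcd (h.trans h'.symm)⟩
    · exact ⟨c, h⟩
  let R : Subgroup B := (ψ.comp (base φ)).range
  let t : Λ → B → A := fun l x => if l = s.1 ∧ x ∈ R then c else 1
  have hR : ∀ h, ψ (base φ h) ∈ R := fun h => ⟨h, rfl⟩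
  obtain ⟨Θ, hΘ1, hΘ2⟩ := gfp_theta ψ (fun l => (1 : Gf l →* A)) t (by
    intro l h x
    simp [t, Subgroup.mul_mem_cancel_left R (hR h)])
  simp only [MonoidHom.one_apply, mul_one] at hΘ2
  have ht1 : ∀ p, p <+: m → ∀ l, t l (ψ (of s.1 s.2 * gfpW φ p))⁻¹ = 1 := by
    intro p hp l
    simp only [t]
    rw [if_neg]
    rintro ⟨-, h⟩
    obtain ⟨h, hh⟩ := R.inv_mem_iff.1 h
    exact hsep' p hp h hh.symm
  have hmid := gfp_mid ψ t Θ hΘ1 hΘ2 m (of s.1 s.2) ht1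
  have hfirst : (Θ (of s.1 s.2)).left 1 = c⁻¹ := by
    have := ht1 [] (by simp) s.1
    simp only [gfpW, List.map_nil, List.prod_nil, mul_one] at this
    rw [hΘ2, mul_one, this]
    simp [t, R.one_mem]
  have hlast : ∀ x, (Θ (of b.1 b.2)).left x = 1 := by
    intro x
    rw [hΘ2]
    simp [t, hsb]
  apply hnd
  refine gfp_det_wreath hK hA hB Θ _ (by rw [hΘ1, h1]) ?_
  rw [e, map_mul, map_mul, RegularWreathProduct.mul_left, Pi.mul_apply, hlast,
    RegularWreathProduct.mul_left, Pi.mul_apply, hΘ1, mul_one (ψ _)⁻¹, hmid, hfirst]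
  simpa using hc

end

/-- Theorem 5: let `G` be the generalized free product (pushout) of a
possibly infinite family `(Gf λ)` of groups amalgamating a common subgroup `H`
(realized by injective homomorphisms `φ λ : H →* Gf λ`). If every `Gf λ` is
`K`-residual and there is a homomorphism from `G` to a group of the root class `K`
that is injective on the canonical image of `H`, then `G` is `K`-residual. -/
theorem generalized_free_product_kResidual (K : GroupClass.{u}) (hK : IsRootClass K)
    (Λ : Type u) (Gf : Λ → Type u) [∀ l, Group (Gf l)] (H : Type u) [Group H]
    (φ : ∀ l, H →* Gf l) (hφ : ∀ l, Function.Injective (φ l))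
    (hG : ∀ l, KResidual K (Gf l))
    (hψ : ∃ (G' : Type u) (_ : Group G'), K G' ∧
      ∃ ψ : Monoid.PushoutI φ →* G',
        Set.InjOn ψ (Set.range (Monoid.PushoutI.base φ))) :
    KResidual K (Monoid.PushoutI φ) := by
  obtain ⟨G', _, hG', ψ, hψ⟩ := hψ
  have hψ' : ∀ h h', ψ (Monoid.PushoutI.base φ h) = ψ (Monoid.PushoutI.base φ h') → h = h' :=
    fun h h' e => Monoid.PushoutI.base_injective hφ (hψ ⟨h, rfl⟩ ⟨h', rfl⟩ e)
  intro g hg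
  have hdet : GfpDet K g := by
    rcases isEmpty_or_nonempty Λ with hΛ | hΛ
    · have : ∃ h, Monoid.PushoutI.base φ h = g := by
        induction g using Monoid.PushoutI.induction_on with
        | of l _ => exact (hΛ.false l).elim
        | base h => exact ⟨h, rfl⟩
        | mul x y hx hy =>
          by_cases hx1 : x = 1
          · subst hx1
            rw [one_mul] at hg ⊢
            exact hy hg
          by_cases hy1 : y = 1
          · subst hy1
            rw [mul_one] at hg ⊢
            exact hx hg
          obtain ⟨a, rfl⟩ := hx hx1
          obtain ⟨b, rfl⟩ := hy hy1
          exact ⟨a * b, map_mul _ _ _⟩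
      obtain ⟨h, rfl⟩ := this
      refine ⟨G', _, ψ, hG', fun h1 => hg ?_⟩
      have : h = 1 := hψ' h 1 (by simpa using h1)
      simp [this]
    · obtain ⟨L, rfl⟩ := gfp_exists_word g
      exact gfp_main hK hG hG' ψ hψ' _ L rfl hg
  obtain ⟨B, _, χ, hB, hχ⟩ := hdet
  exact ⟨χ.ker, inferInstance, gfp_quot_ker hK hB χ, hχ⟩
end

section
/- Gruenberg's criterion: Let 𝒦 be a root class. The following are equivalent: (i) every free product (coproduct) of a family of 𝒦-residual groups is 𝒦-residual; (ii) every free group is 𝒦-residual. -/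
open Pointwise

universe u

lemma K_of_injective {K : GroupClass.{u}} (hK : IsRootClass K) {G P : Type u} [Group G] [Group P]
    (f : G →* P) (hf : Function.Injective f) (hP : K P) : K G :=
  hK.1 f.range G (MonoidHom.ofInjective hf).symm (hK.2.2.1 P hP f.range)

lemma exists_normal_of_hom {K : GroupClass.{u}} (hK : IsRootClass K) {G P : Type u} [Group G]
    [Group P] (f : G →* P) (hP : K P) (g : G) (hg : f g ≠ 1) :
    ∃ (N : Subgroup G) (hN : N.Normal), (letI := hN; K (G ⧸ N)) ∧ g ∉ N :=
  ⟨f.ker, inferInstance, K_of_injective hK (QuotientGroup.kerLift f)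
    (QuotientGroup.kerLift_injective f) hP, by simpa [MonoidHom.mem_ker] using hg⟩

lemma KResidual.exists_hom {K : GroupClass.{u}} {G : Type u} [Group G] (h : KResidual K G)
    (g : G) (hg : g ≠ 1) :
    ∃ (P : Type u) (_ : Group P) (f : G →* P), K P ∧ f g ≠ 1 := by
  obtain ⟨N, hN, h1, h2⟩ := h g hg
  exact ⟨G ⧸ N, inferInstance, QuotientGroup.mk' N, h1, by simpa using h2⟩

lemma KResidual.of_injective {K : GroupClass.{u}} (hK : IsRootClass K) {G A : Type u} [Group G]
    [Group A] (h : KResidual K A) (f : G →* A) (hf : Function.Injective f) : KResidual K G := by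
  intro g hg
  obtain ⟨P, _, e, hP, he⟩ := h.exists_hom (f g) (by simpa using hf.ne hg)
  exact exists_normal_of_hom hK (e.comp f) hP g he

lemma KResidual.extension {K : GroupClass.{u}} (hK : IsRootClass K) {A P : Type u} [Group A]
    [Group P] (f : A →* P) (hP : K P) (h : KResidual K f.ker) : KResidual K A := by
  intro g hg
  by_cases hfg : f g = 1
  · obtain ⟨C, hC, h1, h2⟩ := h ⟨g, hfg⟩ (by simpa [Subtype.ext_iff] using hg)
    obtain ⟨D, hD, hDC, hKD⟩ := hK.2.2.2.2 A f.ker C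
      (K_of_injective hK (QuotientGroup.kerLift f) (QuotientGroup.kerLift_injective f) hP) h1
    refine ⟨D, hD, hKD, fun hgD => h2 ?_⟩
    obtain ⟨x, hx, hxg⟩ := hDC hgD
    have : x = ⟨g, hfg⟩ := Subtype.ext hxg
    rwa [← this]
  · exact exists_normal_of_hom hK f hP g hfg

/-- Left translation action on the free group. -/
def transAct (P ι : Type u) [Group P] : P →* MulAut (FreeGroup (P × ι)) where
  toFun p := FreeGroup.freeGroupCongr (Equiv.prodCongr (Equiv.mulLeft p) (Equiv.refl ι))
  map_one' := by
    ext x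
    induction x using FreeGroup.induction_on <;> simp_all
  map_mul' p q := by
    ext x
    induction x using FreeGroup.induction_on <;> simp_all [mul_assoc, Prod.map]

lemma transAct_of {P ι : Type u} [Group P] (p q : P) (i : ι) :
    transAct P ι p (FreeGroup.of (q, i)) = FreeGroup.of (p * q, i) := by
  simp [transAct]

lemma semidirect_residual {K : GroupClass.{u}} (hK : IsRootClass K)
    (hF : ∀ α : Type u, KResidual K (FreeGroup α)) (P ι : Type u) [Group P] (hP : K P) :
    KResidual K (FreeGroup (P × ι) ⋊[transAct P ι] P) := by
  apply KResidual.extension hK SemidirectProduct.rightHom hP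
  rw [← SemidirectProduct.range_inl_eq_ker_rightHom]
  exact KResidual.of_injective hK (hF _)
    (MonoidHom.ofInjective SemidirectProduct.inl_injective).symm.toMonoidHom
    (MulEquiv.injective _)

section
variable {ι : Type u} {G : ι → Type u} [∀ i, Group (G i)] {P : Type u} [Group P]

/-- The word in the free group. -/
def freeWord (f : ∀ i, G i →* P) : P → List (Σ i, G i) → List ((P × ι) × Bool)
  | _, [] => []
  | p, l :: w => ((p, l.1), true) :: ((p * f l.1 l.2, l.1), false) ::
      freeWord f (p * f l.1 l.2) w

/-- The conjugated embedding. -/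
def conjHom (f : ∀ i, G i →* P) (i : ι) : G i →* (FreeGroup (P × ι) ⋊[transAct P ι] P) :=
  (MulAut.conj (SemidirectProduct.inl (FreeGroup.of ((1 : P), i)))).toMonoidHom.comp
    (SemidirectProduct.inr.comp (f i))

lemma conjHom_left (f : ∀ i, G i →* P) (w : List (Σ i, G i)) (p : P) :
    ((SemidirectProduct.inr p : FreeGroup (P × ι) ⋊[transAct P ι] P) *
      (w.map fun l => conjHom f l.1 l.2).prod).left = FreeGroup.mk (freeWord f p w) := by
  induction w generalizing p with
  | nil => simp [freeWord]; rfl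
  | cons l w ih =>
    have e : (SemidirectProduct.inr p : FreeGroup (P × ι) ⋊[transAct P ι] P) *
        conjHom f l.1 l.2 =
        SemidirectProduct.inl (FreeGroup.of (p, l.1) * (FreeGroup.of (p * f l.1 l.2, l.1))⁻¹) *
          SemidirectProduct.inr (p * f l.1 l.2) := by
      ext <;> simp [conjHom, transAct_of]
    rw [List.map_cons, List.prod_cons, ← mul_assoc, e, mul_assoc, SemidirectProduct.mul_left, ih]
    simp [freeWord, FreeGroup.of, FreeGroup.invRev]

lemma freeWord_reduced (f : ∀ i, G i →* P) (w : List (Σ i, G i)) (p : P)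
    (h1 : ∀ l ∈ w, f l.1 l.2 ≠ 1) (h2 : w.IsChain fun l l' => l.1 ≠ l'.1) :
    FreeGroup.IsReduced (freeWord f p w) := by
  unfold FreeGroup.IsReduced
  induction w generalizing p with
  | nil => simp [freeWord]
  | cons l w ih =>
    have ih' := ih (p * f l.1 l.2) (fun l hl => h1 l (by simp [hl])) h2.tail
    have hl := h1 l (by simp)
    cases w with
    | nil => simpa [freeWord] using hl
    | cons m w =>
      rw [List.isChain_cons_cons] at h2
      simp only [freeWord] at ih' ⊢
      rw [List.isChain_cons_cons, List.isChain_cons_cons]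
      refine ⟨by simpa using hl, by simpa using h2.1, ih'⟩

lemma lift_ne_one (f : ∀ i, G i →* P) (w : Monoid.CoprodI.Word G) (hw : w.toList ≠ [])
    (h : ∀ l ∈ w.toList, f l.1 l.2 ≠ 1) :
    Monoid.CoprodI.lift (conjHom f) w.prod ≠ 1 := by
  classical
  intro h1
  have e := conjHom_left f w.toList 1
  have e2 : (w.toList.map fun l => conjHom f l.1 l.2).prod = 1 := by
    rw [← h1, Monoid.CoprodI.Word.prod, map_list_prod, List.map_map]
    congr 1
  rw [e2] at e
  have hr := (freeWord_reduced f w.toList 1 h w.chain_ne).reduce_eq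
  have e3 : FreeGroup.mk (freeWord f 1 w.toList) = 1 := by rw [← e]; simp
  rw [← FreeGroup.toWord_mk, e3, FreeGroup.toWord_one] at hr
  cases hq : w.toList with
  | nil => exact hw hq
  | cons l t => rw [hq] at hr; simp [freeWord] at hr

lemma exists_homs {K : GroupClass.{u}} (hK : IsRootClass K) (hG : ∀ i, KResidual K (G i))
    (w : List (Σ i, G i)) (h : ∀ l ∈ w, l.2 ≠ 1) :
    ∃ (P : Type u) (_ : Group P) (f : ∀ i, G i →* P), K P ∧ ∀ l ∈ w, f l.1 l.2 ≠ 1 := by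
  classical
  induction w with
  | nil =>
    obtain ⟨P, _, _, hP⟩ := hK.2.1
    exact ⟨P, _, fun _ => 1, hP, by simp⟩
  | cons l w ih =>
    obtain ⟨P, _, f, hP, hf⟩ := ih (fun l hl => h l (by simp [hl]))
    obtain ⟨Q, _, e, hQ, he⟩ := (hG l.1).exists_hom l.2 (h l (by simp))
    refine ⟨P × Q, inferInstance,
      fun i => (f i).prod (if hi : l.1 = i then hi ▸ e else 1), hK.2.2.2.1 _ _ hP hQ, ?_⟩
    intro m hm hm1
    have := Prod.ext_iff.1 hm1
    rcases List.mem_cons.1 hm with rfl | hm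
    · apply he
      simpa using this.2
    · exact hf m hm this.1

end

lemma residual_int {K : GroupClass.{u}} (hK : IsRootClass K)
    (h : ∀ (ι : Type u) (G : ι → Type u) [∀ i, Group (G i)],
      (∀ i, KResidual K (G i)) → KResidual K (Monoid.CoprodI G)) :
    KResidual K (ULift.{u} (Multiplicative ℤ)) := by
  obtain ⟨G, _, _, hG⟩ := hK.2.1
  obtain ⟨a, ha⟩ := exists_ne (1 : G)
  have hr : KResidual K G := fun g hg => exists_normal_of_hom hK (MonoidHom.id G) hG g hg
  let i : ULift.{u} Bool := ⟨false⟩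
  let j : ULift.{u} Bool := ⟨true⟩
  have hij : i ≠ j := by simp [i, j]
  let M : ULift.{u} Bool → Type u := fun _ => G
  let w : Monoid.CoprodI.NeWord M i j :=
    .append (.singleton (M := M) (i := i) a ha) hij (.singleton (M := M) (i := j) a ha)
  have hpow : ∀ n : ℕ, ∃ v : Monoid.CoprodI.NeWord M i j, v.prod = w.prod ^ (n + 1) := by
    intro n
    induction n with
    | zero => exact ⟨w, by simp⟩
    | succ n ih =>
      obtain ⟨v, hv⟩ := ih
      exact ⟨.append v hij.symm w, by rw [Monoid.CoprodI.NeWord.append_prod, hv, ← pow_succ]⟩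
  have hne : ∀ v : Monoid.CoprodI.NeWord M i j, v.prod ≠ 1 := by
    classical
    intro v hv
    have : v.toWord = Monoid.CoprodI.Word.empty :=
      Monoid.CoprodI.Word.equiv.symm.injective (by
        change v.toWord.prod = Monoid.CoprodI.Word.empty.prod
        rw [Monoid.CoprodI.Word.prod_empty]; exact hv)
    exact v.toList_ne_nil (congrArg Monoid.CoprodI.Word.toList this)
  have hfin : ¬ IsOfFinOrder w.prod := by
    rw [isOfFinOrder_iff_pow_eq_one]
    rintro ⟨n, hn, h1⟩
    obtain ⟨v, hv⟩ := hpow (n - 1)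
    rw [Nat.sub_add_cancel hn, h1] at hv
    exact hne v hv
  refine KResidual.of_injective hK (h _ M fun _ => hr)
    ((zpowersHom _ w.prod).comp MulEquiv.ulift.toMonoidHom) ?_
  rw [← injective_zpow_iff_not_isOfFinOrder] at hfin
  intro x y hxy
  apply ULift.ext
  apply Multiplicative.toAdd.injective
  apply hfin
  exact hxy

/-- Gruenberg's criterion: for a root class `K`, every free product
(coproduct) of a family of `K`-residual groups is `K`-residual if and only if every
free group is `K`-residual. -/
theorem coprodI_kResidual_iff_freeGroup_kResidual (K : GroupClass.{u})
    (hK : IsRootClass K) :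
    (∀ (ι : Type u) (G : ι → Type u) [∀ i, Group (G i)],
      (∀ i, KResidual K (G i)) → KResidual K (Monoid.CoprodI G)) ↔
    (∀ α : Type u, KResidual K (FreeGroup α)) := by
  constructor
  · intro h α
    let f : FreeGroup α →* Monoid.CoprodI (fun _ : α => ULift.{u} (Multiplicative ℤ)) :=
      FreeGroup.lift fun i =>
        Monoid.CoprodI.of (M := fun _ : α => ULift.{u} (Multiplicative ℤ)) (i := i)
          ⟨Multiplicative.ofAdd 1⟩
    let g : Monoid.CoprodI (fun _ : α => ULift.{u} (Multiplicative ℤ)) →* FreeGroup α :=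
      Monoid.CoprodI.lift fun i =>
        (zpowersHom _ (FreeGroup.of i)).comp MulEquiv.ulift.toMonoidHom
    have hgf : g.comp f = MonoidHom.id _ := by
      ext i
      simp only [f, g, MonoidHom.comp_apply, FreeGroup.lift_apply_of, Monoid.CoprodI.lift_of]
      exact zpow_one (FreeGroup.of i)
    exact KResidual.of_injective hK (h α _ fun _ => residual_int hK h) f
      (Function.LeftInverse.injective (g := g) fun x => DFunLike.congr_fun hgf x)
  · intro hF ι G _ hG g hg
    classical
    obtain ⟨w, rfl⟩ := (Monoid.CoprodI.Word.equiv (M := G)).symm.surjective g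
    change w.prod ≠ 1 at hg
    obtain ⟨P, _, f, hP, hf⟩ := exists_homs hK hG w.toList w.ne_one
    have hw : w.toList ≠ [] := by
      intro h
      apply hg
      simp [Monoid.CoprodI.Word.prod, h]
    obtain ⟨Q, _, e, hQ, he⟩ := (semidirect_residual hK hF P ι hP).exists_hom _
      (lift_ne_one f w hw hf)
    exact exists_normal_of_hom hK (e.comp (Monoid.CoprodI.lift (conjHom f))) hQ _ he
end
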